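/- Let d ≥ 2, let 0 < α ≤ 1, let Ω ⊆ ℝ^d be open, bounded and nonempty, and let g ∈ L^∞_α. Then |Ω|^{2/d} λ₁^g(Ω) ≥ (1 + α^{d/(d-1)})^{2/d} |B|^{2/d} λ₁(B), where B is the open unit ball of ℝ^d. -/

import Mathlib

open MeasureTheory Metric Set Filter

open scoped Classical ENNReal

noncomputable section

/-- The Rayleigh quotient of `u : ℝ^d → ℝ`. -/
def rayleigh (d : ℕ) (u : EuclideanSpace ℝ (Fin d) → ℝ) : ℝ :=
  (∫ x, ‖gradient u x‖ ^ 2) / (∫ x, (u x) ^ 2)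

/-- A trial function for the Dirichlet eigenvalue on `Ω`: Lipschitz, vanishing outside `Ω`,
and not almost everywhere zero. -/
def IsDirTrial (d : ℕ) (Ω : Set (EuclideanSpace ℝ (Fin d)))
    (u : EuclideanSpace ℝ (Fin d) → ℝ) : Prop :=
  (∃ K, LipschitzWith K u) ∧ (∀ x ∉ Ω, u x = 0) ∧ ¬ (u =ᵐ[volume] fun _ => (0 : ℝ))

/-- The first Dirichlet eigenvalue of `Ω`. -/
def dirichletEV (d : ℕ) (Ω : Set (EuclideanSpace ℝ (Fin d))) : ℝ :=
  sInf { r | ∃ u, IsDirTrial d Ω u ∧ rayleigh d u = r }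

/-- The first twisted eigenvalue of `Ω` with orthogonality constraint `g`. -/
def twistedEV (d : ℕ) (Ω : Set (EuclideanSpace ℝ (Fin d)))
    (g : EuclideanSpace ℝ (Fin d) → ℝ) : ℝ :=
  sInf { r | ∃ u, IsDirTrial d Ω u ∧ (∫ x, u x * g x) = 0 ∧ rayleigh d u = r }

/-- `u` is a minimizer for the first twisted eigenvalue `λ₁^g(Ω)`. -/
def IsTwistedMin (d : ℕ) (Ω : Set (EuclideanSpace ℝ (Fin d)))
    (g u : EuclideanSpace ℝ (Fin d) → ℝ) : Prop :=
  IsDirTrial d Ω u ∧ (∫ x, u x * g x) = 0 ∧ rayleigh d u = twistedEV d Ω g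

/-- The bang-bang function equal to `1` on `Bm` and `α` elsewhere. -/
def chiBang (d : ℕ) (α : ℝ) (Bm : Set (EuclideanSpace ℝ (Fin d))) :
    EuclideanSpace ℝ (Fin d) → ℝ :=
  fun x => if x ∈ Bm then 1 else α

/-- One-dimensional Brunn–Minkowski inequality. -/
theorem volume_add_volume_le_of_add_subset {A B C : Set ℝ} (hA : MeasurableSet A)
    (hB : MeasurableSet B) (hAn : A.Nonempty) (hBn : B.Nonempty)
    (h : ∀ x ∈ A, ∀ y ∈ B, x + y ∈ C) : volume A + volume B ≤ volume C := by
  have key : ∀ K ⊆ A, IsCompact K → ∀ L ⊆ B, IsCompact L → K.Nonempty → L.Nonempty →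
      volume K + volume L ≤ volume C := by
    intro K hK hKc L hL hLc hKn hLn
    obtain ⟨a, haK, ha⟩ := hKc.exists_isGreatest hKn
    obtain ⟨b, hbL, hb⟩ := hLc.exists_isLeast hLn
    have e1 : volume ((fun x => x + b) '' K) = volume K := by
      simp
    have e2 : volume ((fun x => a + x) '' L) = volume L := by
      simp
    rw [← e1, ← e2]
    have hm : MeasurableSet ((fun x => a + x) '' L) :=
      (hLc.image (by fun_prop)).measurableSet
    have hd : AEDisjoint volume ((fun x => x + b) '' K) ((fun x => a + x) '' L) := by
      have : ((fun x => x + b) '' K) ∩ ((fun x => a + x) '' L) ⊆ {a + b} := by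
        rintro _ ⟨⟨x, hx, rfl⟩, ⟨y, hy, hxy⟩⟩
        have h1 := ha hx
        have h2 := hb hy
        simp only at hxy
        simp only [mem_singleton_iff]
        linarith
      exact measure_mono_null this (by simp)
    rw [← measure_union₀ hm.nullMeasurableSet hd]
    apply measure_mono
    rintro _ (⟨x, hx, rfl⟩ | ⟨y, hy, rfl⟩)
    · exact h _ (hK hx) _ (hL hbL)
    · exact h _ (hK haK) _ (hL hy)
  obtain ⟨a0, ha0⟩ := hAn
  obtain ⟨b0, hb0⟩ := hBn
  have key2 : ∀ K ⊆ A, IsCompact K → ∀ L ⊆ B, IsCompact L → volume K + volume L ≤ volume C := by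
    intro K hK hKc L hL hLc
    refine le_trans (add_le_add (measure_mono (subset_insert a0 K))
      (measure_mono (subset_insert b0 L))) ?_
    exact key _ (insert_subset ha0 hK) (hKc.insert a0) _ (insert_subset hb0 hL) (hLc.insert b0)
      (insert_nonempty _ _) (insert_nonempty _ _)
  have step : ∀ K ⊆ A, IsCompact K → volume K + volume B ≤ volume C := by
    intro K hK hKc
    rw [hB.measure_eq_iSup_isCompact, ENNReal.add_iSup]
    refine iSup_le fun L => ?_
    by_cases hL : L ⊆ B
    · by_cases hLc : IsCompact L
      · simpa [hL, hLc] using key2 K hK hKc L hL hLc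
      · simpa [hL, hLc] using key2 K hK hKc ∅ (empty_subset _) isCompact_empty
    · simpa [hL] using key2 K hK hKc ∅ (empty_subset _) isCompact_empty
  rw [hA.measure_eq_iSup_isCompact, ENNReal.iSup_add]
  refine iSup_le fun K => ?_
  by_cases hK : K ⊆ A
  · by_cases hKc : IsCompact K
    · simpa [hK, hKc] using step K hK hKc
    · simpa [hK, hKc] using step ∅ (empty_subset _) isCompact_empty
  · simpa [hK] using step ∅ (empty_subset _) isCompact_empty

theorem lintegral_eq_lintegral_meas_ofReal_lt {α : Type*} [MeasurableSpace α] (μ : Measure α)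
    {f : α → ℝ≥0∞} (hf : Measurable f) (hfin : ∀ x, f x ≠ ∞) :
    ∫⁻ x, f x ∂μ = ∫⁻ t in Ioi (0 : ℝ), μ {x | ENNReal.ofReal t < f x} := by
  have h := lintegral_eq_lintegral_meas_lt μ (f := fun x => (f x).toReal)
    (ae_of_all _ fun x => ENNReal.toReal_nonneg) hf.ennreal_toReal.aemeasurable
  rw [lintegral_congr fun x => (ENNReal.ofReal_toReal (hfin x)).symm, h]
  refine setLIntegral_congr_fun measurableSet_Ioi fun t ht => ?_
  congr 1
  ext x
  simp only [mem_ofPred_eq]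
  rw [ENNReal.ofReal_lt_iff_lt_toReal (le_of_lt ht) (hfin x)]

/-- Prékopa–Leindler on the line for functions with supremum one. -/
theorem prekopa_leindler_real_normalized {a b : ℝ} (ha : 0 < a) (hb : 0 < b) (hab : a + b = 1)
    {f g h : ℝ → ℝ≥0∞} (hf : Measurable f) (hg : Measurable g) (hh : Measurable h)
    (hf1 : ⨆ x, f x = 1) (hg1 : ⨆ x, g x = 1)
    (H : ∀ x y, f x ^ a * g y ^ b ≤ h (a * x + b * y)) :
    ENNReal.ofReal a * (∫⁻ x, f x) + ENNReal.ofReal b * (∫⁻ x, g x) ≤ ∫⁻ x, h x := by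
  have hfle : ∀ x, f x ≤ 1 := fun x => hf1 ▸ le_iSup f x
  have hgle : ∀ x, g x ≤ 1 := fun x => hg1 ▸ le_iSup g x
  have hone : ∀ k : ℝ → ℝ≥0∞, Measurable k → (∀ x, k x ≤ 1) →
      ∫⁻ x, k x = ∫⁻ t in Ioo (0 : ℝ) 1, volume {x | ENNReal.ofReal t < k x} := by
    intro k hk hk1
    rw [lintegral_eq_lintegral_meas_ofReal_lt volume hk
      (fun x => ne_top_of_le_ne_top ENNReal.one_ne_top (hk1 x)), ← Ioo_union_Ici_eq_Ioi one_pos,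
      lintegral_union measurableSet_Ici (by
        rw [disjoint_left]; intro x hx hx'; exact absurd hx.2 (not_lt.2 hx'))]
    rw [setLIntegral_congr_fun (g := fun _ => 0) measurableSet_Ici]
    · simp
    · intro t ht
      have : {x | ENNReal.ofReal t < k x} = ∅ := by
        ext x
        simp only [mem_ofPred_eq, mem_empty_iff_false, iff_false, not_lt]
        exact (hk1 x).trans (by simpa using ht)
      simp only [this, measure_empty]
  have hmin : ∫⁻ x, min (h x) 1 ≤ ∫⁻ x, h x := lintegral_mono fun x => min_le_left _ _
  refine le_trans ?_ hmin
  rw [hone f hf hfle, hone g hg hgle, hone _ (hh.min measurable_const) (fun x => min_le_right _ _),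
    ← lintegral_const_mul' _ _ ENNReal.ofReal_ne_top,
    ← lintegral_const_mul' _ _ ENNReal.ofReal_ne_top]
  have hmono : ∀ k : ℝ → ℝ≥0∞, Antitone fun t : ℝ => volume {x | ENNReal.ofReal t < k x} := by
    intro k s t hst
    exact measure_mono fun x (hx : _ < _) => lt_of_le_of_lt (ENNReal.ofReal_le_ofReal hst) hx
  rw [← lintegral_add_left ((hmono f).measurable.const_mul _)]
  refine setLIntegral_mono' measurableSet_Ioo fun t ht => ?_
  have hscale : ∀ (c : ℝ) (S : Set ℝ), 0 < c →
      ENNReal.ofReal c * volume S = volume ((fun x => c * x) '' S) := by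
    intro c S hc
    have := Measure.addHaar_smul_of_nonneg volume hc.le S
    simp only [Module.finrank_self, pow_one] at this
    rw [← this]; rfl
  rw [hscale a _ ha, hscale b _ hb]
  have ht1 : ENNReal.ofReal t < 1 := by simpa using ht.2
  have hne : ∀ k : ℝ → ℝ≥0∞, ⨆ x, k x = 1 → {x | ENNReal.ofReal t < k x}.Nonempty := by
    intro k hk
    rw [← hk] at ht1
    obtain ⟨x, hx⟩ := lt_iSup_iff.1 ht1
    exact ⟨x, hx⟩
  have hmeas : ∀ (c : ℝ) (k : ℝ → ℝ≥0∞), 0 < c → Measurable k →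
      MeasurableSet ((fun x => c * x) '' {x | ENNReal.ofReal t < k x}) := by
    intro c k hc hk
    have hS : MeasurableSet {x | ENNReal.ofReal t < k x} := measurableSet_lt measurable_const hk
    exact hS.const_smul₀ c
  refine volume_add_volume_le_of_add_subset (hmeas a f ha hf) (hmeas b g hb hg)
    ((hne f hf1).image _) ((hne g hg1).image _) ?_
  rintro _ ⟨x, hx, rfl⟩ _ ⟨y, hy, rfl⟩
  simp only [mem_ofPred_eq] at hx hy ⊢
  refine lt_min (lt_of_lt_of_le ?_ (H x y)) ht1
  calc ENNReal.ofReal t = ENNReal.ofReal t ^ a * ENNReal.ofReal t ^ b := by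
        rw [← ENNReal.rpow_add _ _ (by simpa using ht.1) ENNReal.ofReal_ne_top, hab,
          ENNReal.rpow_one]
    _ < f x ^ a * g y ^ b := by
        exact ENNReal.mul_lt_mul (ENNReal.rpow_lt_rpow hx ha) (ENNReal.rpow_lt_rpow hy hb)

theorem ENNReal.geom_mean_le_arith_mean2 {a b : ℝ} (ha : 0 < a) (hb : 0 < b) (hab : a + b = 1)
    (x y : ℝ≥0∞) : x ^ a * y ^ b ≤ ENNReal.ofReal a * x + ENNReal.ofReal b * y := by
  have hpq : (a⁻¹).HolderConjugate b⁻¹ := by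
    rw [Real.holderConjugate_iff]
    refine ⟨(one_lt_inv₀ ha).2 (by linarith), by simpa using hab⟩
  have := ENNReal.young_inequality (x ^ a) (y ^ b) hpq
  rw [← ENNReal.rpow_mul, ← ENNReal.rpow_mul, mul_inv_cancel₀ ha.ne', mul_inv_cancel₀ hb.ne',
    ENNReal.rpow_one, ENNReal.rpow_one, ENNReal.ofReal_inv_of_pos ha, ENNReal.ofReal_inv_of_pos hb,
    ENNReal.div_eq_inv_mul, ENNReal.div_eq_inv_mul, inv_inv, inv_inv] at this
  exact this

theorem prekopa_leindler_real {a b : ℝ} (ha : 0 < a) (hb : 0 < b) (hab : a + b = 1)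
    {f g h : ℝ → ℝ≥0∞} (hf : Measurable f) (hg : Measurable g) (hh : Measurable h)
    (H : ∀ x y, f x ^ a * g y ^ b ≤ h (a * x + b * y)) :
    (∫⁻ x, f x) ^ a * (∫⁻ x, g x) ^ b ≤ ∫⁻ x, h x := by
  have bdd : ∀ (f g : ℝ → ℝ≥0∞), Measurable f → Measurable g → (⨆ x, f x) ≠ ∞ → (⨆ x, g x) ≠ ∞ →
      (∀ x y, f x ^ a * g y ^ b ≤ h (a * x + b * y)) →
      (∫⁻ x, f x) ^ a * (∫⁻ x, g x) ^ b ≤ ∫⁻ x, h x := by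
    intro f g hf hg hfT hgT H
    set F := ⨆ x, f x with hF
    set G := ⨆ x, g x with hG
    by_cases hF0 : F = 0
    · have : ∀ x, f x = 0 := fun x => by
        have := le_iSup f x; rw [← hF, hF0] at this; simpa using this
      simp [this, ENNReal.zero_rpow_of_pos ha]
    by_cases hG0 : G = 0
    · have : ∀ x, g x = 0 := fun x => by
        have := le_iSup g x; rw [← hG, hG0] at this; simpa using this
      simp [this, ENNReal.zero_rpow_of_pos hb]
    set c := F ^ a * G ^ b with hc
    have hFa0 : F ^ a ≠ 0 := by simp [hF0, hfT]
    have hGb0 : G ^ b ≠ 0 := by simp [hG0, hgT]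
    have hFaT : F ^ a ≠ ∞ := by simp [hfT, ha.le]
    have hGbT : G ^ b ≠ ∞ := by simp [hgT, hb.le]
    have hc0 : c ≠ 0 := mul_ne_zero hFa0 hGb0
    have hcT : c ≠ ∞ := ENNReal.mul_ne_top hFaT hGbT
    have hcinv : c⁻¹ = (F⁻¹) ^ a * (G⁻¹) ^ b := by
      rw [hc, ENNReal.mul_inv (Or.inl hFa0) (Or.inl hFaT), ENNReal.inv_rpow, ENNReal.inv_rpow]
    have hn := prekopa_leindler_real_normalized ha hb hab (hf.const_mul F⁻¹) (hg.const_mul G⁻¹)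
      (hh.const_mul c⁻¹) (by rw [← ENNReal.mul_iSup, ← hF, ENNReal.inv_mul_cancel hF0 hfT])
      (by rw [← ENNReal.mul_iSup, ← hG, ENNReal.inv_mul_cancel hG0 hgT]) (by
        intro x y
        rw [ENNReal.mul_rpow_of_nonneg _ _ ha.le, ENNReal.mul_rpow_of_nonneg _ _ hb.le, hcinv]
        calc F⁻¹ ^ a * f x ^ a * (G⁻¹ ^ b * g y ^ b)
            = F⁻¹ ^ a * G⁻¹ ^ b * (f x ^ a * g y ^ b) := by ring
          _ ≤ _ := by gcongr; exact H x y)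
    have hn2 := (ENNReal.geom_mean_le_arith_mean2 ha hb hab _ _).trans hn
    rw [lintegral_const_mul _ hf, lintegral_const_mul _ hg, lintegral_const_mul _ hh,
      ENNReal.mul_rpow_of_nonneg _ _ ha.le, ENNReal.mul_rpow_of_nonneg _ _ hb.le] at hn2
    have hn3 : c⁻¹ * ((∫⁻ x, f x) ^ a * (∫⁻ x, g x) ^ b) ≤ c⁻¹ * ∫⁻ x, h x := by
      refine le_trans (le_of_eq ?_) hn2
      rw [hcinv]; ring
    have := mul_le_mul_right hn3 c
    rwa [← mul_assoc, ENNReal.mul_inv_cancel hc0 hcT, one_mul, ← mul_assoc,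
      ENNReal.mul_inv_cancel hc0 hcT, one_mul] at this
  have hlim : ∀ k : ℝ → ℝ≥0∞, Measurable k →
      Tendsto (fun n : ℕ => ∫⁻ x, min (k x) n) atTop (nhds (∫⁻ x, k x)) := by
    intro k hk
    refine lintegral_tendsto_of_tendsto_of_monotone
      (fun n => (hk.min measurable_const).aemeasurable) ?_ ?_
    · refine ae_of_all _ fun x m n hmn => ?_
      simp only
      gcongr
    · refine ae_of_all _ fun x => ?_
      have : Tendsto (fun n : ℕ => min (k x) (n : ℝ≥0∞)) atTop (nhds (min (k x) ∞)) :=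
        tendsto_const_nhds.min ENNReal.tendsto_nat_nhds_top
      simpa using this
  by_cases hf0 : ∫⁻ x, f x = 0
  · simp [hf0, ENNReal.zero_rpow_of_pos ha]
  by_cases hg0 : ∫⁻ x, g x = 0
  · simp [hg0, ENNReal.zero_rpow_of_pos hb]
  have hT : Tendsto (fun n : ℕ => (∫⁻ x, min (f x) n) ^ a * (∫⁻ x, min (g x) n) ^ b) atTop
      (nhds ((∫⁻ x, f x) ^ a * (∫⁻ x, g x) ^ b)) := by
    refine ENNReal.Tendsto.mul ((hlim f hf).ennrpow_const a) (Or.inl ?_)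
      ((hlim g hg).ennrpow_const b) (Or.inl ?_)
    · simp [hf0, ha.le, ha]
    · simp [hg0, hb.le, hb]
  refine le_of_tendsto' hT fun n => ?_
  refine bdd _ _ (hf.min measurable_const) (hg.min measurable_const) ?_ ?_ ?_
  · exact ne_top_of_le_ne_top (ENNReal.natCast_ne_top n) (iSup_le fun x => min_le_right _ _)
  · exact ne_top_of_le_ne_top (ENNReal.natCast_ne_top n) (iSup_le fun x => min_le_right _ _)
  · intro x y
    refine le_trans ?_ (H x y)
    gcongr
    · exact min_le_left _ _
    · exact min_le_left _ _

/-- The Prékopa–Leindler inequality. -/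
theorem prekopa_leindler {a b : ℝ} (ha : 0 < a) (hb : 0 < b) (hab : a + b = 1) (n : ℕ) :
    ∀ {f g h : (Fin n → ℝ) → ℝ≥0∞}, Measurable f → Measurable g → Measurable h →
    (∀ x y, f x ^ a * g y ^ b ≤ h (a • x + b • y)) →
    (∫⁻ x, f x) ^ a * (∫⁻ x, g x) ^ b ≤ ∫⁻ x, h x := by
  induction n with
  | zero =>
    intro f g h hf hg hh H
    have e : ∀ k : (Fin 0 → ℝ) → ℝ≥0∞, ∫⁻ x, k x = k 0 := by
      intro k
      rw [lintegral_unique, volume_pi, Measure.pi_of_empty, measure_univ, mul_one]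
      exact congrArg k (Subsingleton.elim _ _)
    rw [e, e, e]
    have h0 := H 0 0
    rwa [Subsingleton.elim (a • (0 : Fin 0 → ℝ) + b • 0) 0] at h0
  | succ n ih =>
    intro f g h hf hg hh H
    let T := (MeasurableEquiv.piFinSuccAbove (fun _ : Fin (n + 1) => ℝ) 0).symm
    have hT : MeasurePreserving T volume volume :=
      (volume_preserving_piFinSuccAbove (fun _ : Fin (n + 1) => ℝ) 0).symm _
    have e : ∀ k : (Fin (n + 1) → ℝ) → ℝ≥0∞, Measurable k →
        ∫⁻ x, k x = ∫⁻ t, ∫⁻ y, k (T (t, y)) := by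
      intro k hk
      rw [← hT.lintegral_comp hk, Measure.volume_eq_prod,
        lintegral_prod (fun z => k (T z)) (hk.comp T.measurable).aemeasurable]
    have hm : ∀ k : (Fin (n + 1) → ℝ) → ℝ≥0∞, Measurable k →
        Measurable fun t : ℝ => ∫⁻ y, k (T (t, y)) := by
      intro k hk
      exact (hk.comp T.measurable).lintegral_prod_right'
    have hs : ∀ (k : (Fin (n + 1) → ℝ) → ℝ≥0∞), Measurable k → ∀ t : ℝ,
        Measurable fun y => k (T (t, y)) := by
      intro k hk t
      exact (hk.comp T.measurable).comp measurable_prodMk_left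
    rw [e f hf, e g hg, e h hh]
    refine prekopa_leindler_real ha hb hab (hm f hf) (hm g hg) (hm h hh) fun s t => ?_
    refine ih (hs f hf s) (hs g hg t) (hs h hh _) fun x y => ?_
    have hlin : T (a * s + b * t, a • x + b • y) = a • T (s, x) + b • T (t, y) := by
      ext i
      refine Fin.cases ?_ (fun j => ?_) i
      · simp [T, MeasurableEquiv.piFinSuccAbove]
      · simp [T, MeasurableEquiv.piFinSuccAbove]
    rw [hlin]
    exact H _ _

theorem prekopa_leindler_euclidean {a b : ℝ} (ha : 0 < a) (hb : 0 < b) (hab : a + b = 1) {d : ℕ}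
    {f g h : EuclideanSpace ℝ (Fin d) → ℝ≥0∞} (hf : Measurable f) (hg : Measurable g)
    (hh : Measurable h) (H : ∀ x y, f x ^ a * g y ^ b ≤ h (a • x + b • y)) :
    (∫⁻ x, f x) ^ a * (∫⁻ x, g x) ^ b ≤ ∫⁻ x, h x := by
  have hT := EuclideanSpace.volume_preserving_symm_measurableEquiv_toLp (Fin d)
  have hT' := hT.symm
  rw [← hT'.lintegral_comp hf, ← hT'.lintegral_comp hg, ← hT'.lintegral_comp hh]
  refine prekopa_leindler ha hb hab d (hf.comp (MeasurableEquiv.measurable _))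
    (hg.comp (MeasurableEquiv.measurable _)) (hh.comp (MeasurableEquiv.measurable _)) ?_
  intro x y
  exact H _ _

open scoped Pointwise in
/-- Brunn–Minkowski inequality for the sum with a ball, in terms of volume radii. -/
theorem volume_ball_add_le {d : ℕ} {a ε : ℝ} (ha : 0 < a) (hε : 0 < ε)
    {A C : Set (EuclideanSpace ℝ (Fin d))} (hA : MeasurableSet A) (hC : MeasurableSet C)
    (hvol : volume (ball (0 : EuclideanSpace ℝ (Fin d)) a) ≤ volume A)
    (hAC : ∀ x ∈ A, ∀ y, ‖y‖ < ε → x + y ∈ C) :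
    volume (ball (0 : EuclideanSpace ℝ (Fin d)) (a + ε)) ≤ volume C := by
  have hs : 0 < a + ε := by positivity
  set p := a / (a + ε) with hp
  set q := ε / (a + ε) with hq
  have hp0 : 0 < p := by positivity
  have hq0 : 0 < q := by positivity
  have hpq : p + q = 1 := by rw [hp, hq]; field_simp
  have hsm : ∀ (c : ℝ) (S : Set (EuclideanSpace ℝ (Fin d))), 0 < c → MeasurableSet S →
      ∫⁻ x, S.indicator (fun _ => (1 : ℝ≥0∞)) (c • x) = ENNReal.ofReal ((c⁻¹) ^ d) * volume S := by
    intro c S hc hS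
    have e : (fun x => S.indicator (fun _ => (1 : ℝ≥0∞)) (c • x)) =
        (c⁻¹ • S).indicator fun _ => (1 : ℝ≥0∞) := by
      ext x
      simp only [indicator, mem_inv_smul_set_iff₀ hc.ne']
    rw [e, lintegral_indicator_const (hS.const_smul₀ _), one_mul,
      Measure.addHaar_smul_of_nonneg _ (inv_nonneg.2 hc.le)]
    simp
  have hball : ∀ (c r : ℝ), 0 < c → 
      ENNReal.ofReal (c ^ d) * volume (ball (0 : EuclideanSpace ℝ (Fin d)) r) =
        volume (ball (0 : EuclideanSpace ℝ (Fin d)) (c * r)) := by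
    intro c r hc
    rw [Measure.addHaar_ball_mul_of_pos _ _ hc]
    simp
  have hPL := prekopa_leindler_euclidean hp0 hq0 hpq
    (f := fun x => A.indicator (fun _ => (1 : ℝ≥0∞)) (p • x))
    (g := fun x => (ball (0 : EuclideanSpace ℝ (Fin d)) ε).indicator (fun _ => (1 : ℝ≥0∞)) (q • x))
    (h := C.indicator (fun _ => (1 : ℝ≥0∞)))
    ((measurable_const.indicator hA).comp (measurable_const_smul p))
    ((measurable_const.indicator measurableSet_ball).comp (measurable_const_smul q))
    (measurable_const.indicator hC) (by
      intro x y
      by_cases hx : p • x ∈ A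
      · by_cases hy : q • y ∈ ball (0 : EuclideanSpace ℝ (Fin d)) ε
        · have := hAC _ hx (q • y) (by simpa using hy)
          simp [hx, hy, this]
        · simp [indicator_of_notMem hy, ENNReal.zero_rpow_of_pos hq0]
      · simp [hx, ENNReal.zero_rpow_of_pos hp0])
  rw [hsm p A hp0 hA, hsm q _ hq0 measurableSet_ball, hball _ _ (inv_pos.2 hq0),
    lintegral_indicator_const hC, one_mul] at hPL
  refine le_trans ?_ hPL
  have h1 : volume (ball (0 : EuclideanSpace ℝ (Fin d)) (a + ε)) ≤
      ENNReal.ofReal (p⁻¹ ^ d) * volume A := by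
    have : a + ε = p⁻¹ * a := by rw [hp]; field_simp
    rw [this, ← hball _ _ (inv_pos.2 hp0)]
    gcongr
  have h2 : q⁻¹ * ε = a + ε := by rw [hq]; field_simp
  rw [h2]
  set X := volume (ball (0 : EuclideanSpace ℝ (Fin d)) (a + ε)) with hX
  have hX0 : X ≠ 0 := (measure_ball_pos _ _ hs).ne'
  have hXT : X ≠ ∞ := measure_ball_lt_top.ne
  calc X = X ^ p * X ^ q := by rw [← ENNReal.rpow_add _ _ hX0 hXT, hpq, ENNReal.rpow_one]
    _ ≤ _ := by gcongr

theorem fderiv_clamp {E : Type*} [NormedAddCommGroup E] [NormedSpace ℝ E] {u : E → ℝ}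
    (hu : Continuous u) (a b : ℝ) (x : E) :
    fderiv ℝ (fun x => max a (min (u x) b)) x =
      {x | a < u x ∧ u x < b}.indicator (fderiv ℝ u) x := by
  by_cases hab : b ≤ a
  · have : (fun x => max a (min (u x) b)) = fun _ => a := by
      ext y; exact max_eq_left ((min_le_right _ _).trans hab)
    rw [this, indicator_of_notMem]
    · simp
    · rintro ⟨h1, h2⟩; linarith
  push Not at hab
  by_cases hx : x ∈ {x | a < u x ∧ u x < b}
  · rw [indicator_of_mem hx]
    apply Filter.EventuallyEq.fderiv_eq
    have : {x | a < u x ∧ u x < b} ∈ nhds x :=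
      ((isOpen_lt continuous_const hu).inter (isOpen_lt hu continuous_const)).mem_nhds hx
    filter_upwards [this] with y hy
    rw [min_eq_left hy.2.le, max_eq_right hy.1.le]
  · rw [indicator_of_notMem hx]
    rcases le_or_gt (u x) a with h | h
    · apply IsLocalMin.fderiv_eq_zero
      refine Eventually.of_forall fun y => ?_
      dsimp only
      rw [min_eq_left (h.trans hab.le), max_eq_left h]
      exact le_max_left _ _
    · have h2 : b ≤ u x := not_lt.1 fun h2 => hx ⟨h, h2⟩
      apply IsLocalMax.fderiv_eq_zero
      refine Eventually.of_forall fun y => ?_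
      dsimp only
      rw [min_eq_right h2, max_eq_right hab.le]
      exact max_le hab.le (min_le_right _ _)

/-- The supremum of `f` over the ball of radius `ε`. -/
def ballSup {E : Type*} [NormedAddCommGroup E] (f : E → ℝ) (ε : ℝ) (x : E) : ℝ :=
  ⨆ y : ball (0 : E) ε, f (x + y)

section ballSup

variable {E : Type*} [NormedAddCommGroup E] {f : E → ℝ} {M ε : ℝ}

theorem bddAbove_range_ballSup (hM : ∀ x, f x ≤ M) (x : E) :
    BddAbove (range fun y : ball (0 : E) ε => f (x + y)) :=
  ⟨M, by rintro _ ⟨y, rfl⟩; exact hM _⟩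

theorem lt_ballSup_iff (hM : ∀ x, f x ≤ M) (hε : 0 < ε) {x : E} {t : ℝ} :
    t < ballSup f ε x ↔ ∃ y, ‖y‖ < ε ∧ t < f (x + y) := by
  have : Nonempty (ball (0 : E) ε) := ⟨⟨0, by simpa using hε⟩⟩
  rw [ballSup, lt_ciSup_iff (bddAbove_range_ballSup hM x)]
  constructor
  · rintro ⟨y, hy⟩; exact ⟨y, mem_ball_zero_iff.1 y.2, hy⟩
  · rintro ⟨y, hy, h⟩; exact ⟨⟨y, by simpa using hy⟩, h⟩

theorem ballSup_le (hε : 0 < ε) {x : E} {c : ℝ} (h : ∀ y, ‖y‖ < ε → f (x + y) ≤ c) :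
    ballSup f ε x ≤ c := by
  have : Nonempty (ball (0 : E) ε) := ⟨⟨0, by simpa using hε⟩⟩
  exact ciSup_le fun y => h y (mem_ball_zero_iff.1 y.2)

theorem le_ballSup (hM : ∀ x, f x ≤ M) (hε : 0 < ε) (x : E) : f x ≤ ballSup f ε x := by
  calc f x = f (x + 0) := by rw [add_zero]
    _ ≤ _ := le_ciSup (bddAbove_range_ballSup (ε := ε) hM x) ⟨0, by simpa using hε⟩

theorem isOpen_lt_ballSup (hM : ∀ x, f x ≤ M) (hf : Continuous f) (hε : 0 < ε) (t : ℝ) :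
    IsOpen {x | t < ballSup f ε x} := by
  have : {x | t < ballSup f ε x} = ⋃ y ∈ ball (0 : E) ε, {x | t < f (x + y)} := by
    ext x
    simp only [mem_ofPred_eq, lt_ballSup_iff hM hε, mem_iUnion, mem_ball_zero_iff, exists_prop]
  rw [this]
  exact isOpen_biUnion fun y _ => isOpen_lt continuous_const (hf.comp (by fun_prop))

theorem measurable_ballSup [MeasurableSpace E] [BorelSpace E] (hM : ∀ x, f x ≤ M)
    (hf : Continuous f) (hε : 0 < ε) : Measurable (ballSup f ε) :=
  measurable_of_Ioi fun t => (isOpen_lt_ballSup hM hf hε t).measurableSet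

theorem limsup_ballSup_le [NormedSpace ℝ E] {x : E} (hf : DifferentiableAt ℝ f x) {e : ℕ → ℝ}
    (he : ∀ n, 0 < e n) (he0 : Tendsto e atTop (nhds 0)) :
    limsup (fun n => ENNReal.ofReal ((ballSup f (e n) x - f x) / e n)) atTop ≤
      ‖fderiv ℝ f x‖ₑ := by
  refine ENNReal.le_of_forall_pos_le_add fun δ hδ _ => ?_
  have hδ' : (0 : ℝ) < δ := hδ
  have h0 := hasFDerivAt_iff_isLittleO_nhds_zero.1 hf.hasFDerivAt
  have h1 := h0.def hδ'
  obtain ⟨r, hr, hball⟩ := Metric.eventually_nhds_iff.1 h1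
  refine limsup_le_of_le (by isBoundedDefault) ?_
  filter_upwards [he0.eventually (gt_mem_nhds hr)] with n hn
  have : ‖fderiv ℝ f x‖ₑ + (δ : ℝ≥0∞) = ENNReal.ofReal (‖fderiv ℝ f x‖ + δ) := by
    rw [ENNReal.ofReal_add (norm_nonneg _) hδ'.le, ofReal_norm, ENNReal.ofReal_coe_nnreal]
  rw [this]
  apply ENNReal.ofReal_le_ofReal
  rw [div_le_iff₀ (he n), sub_le_iff_le_add]
  refine ballSup_le (he n) fun y hy => ?_
  have h2 := hball (y := y) (by simpa using hy.trans hn)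
  have h3 := (abs_le.1 (Real.norm_eq_abs _ ▸ h2)).2
  have h4 : fderiv ℝ f x y ≤ ‖fderiv ℝ f x‖ * ‖y‖ :=
    (le_abs_self _).trans ((fderiv ℝ f x).le_opNorm y)
  have h5 : ‖fderiv ℝ f x‖ * ‖y‖ ≤ ‖fderiv ℝ f x‖ * e n := by gcongr
  have h6 : (δ : ℝ) * ‖y‖ ≤ δ * e n := by gcongr
  linarith

end ballSup

/-- Growth of the volume under enlargement by a small ball. -/
theorem volume_add_le_of_ball_add {d : ℕ} (hd : d ≠ 0) {a ε : ℝ} (ha : 0 < a) (hε : 0 < ε)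
    {A C : Set (EuclideanSpace ℝ (Fin d))} (hA : MeasurableSet A) (hC : MeasurableSet C)
    (hAfin : volume A ≠ ∞)
    (hvol : volume (ball (0 : EuclideanSpace ℝ (Fin d)) a) ≤ volume A)
    (hAC : ∀ x ∈ A, ∀ y, ‖y‖ < ε → x + y ∈ C) :
    volume A + ENNReal.ofReal (d * a ^ (d - 1) * ε) *
      volume (ball (0 : EuclideanSpace ℝ (Fin d)) 1) ≤ volume C := by
  set ω := volume (ball (0 : EuclideanSpace ℝ (Fin d)) 1) with hω
  have hω0 : ω ≠ 0 := (measure_ball_pos _ _ one_pos).ne'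
  have hωT : ω ≠ ∞ := measure_ball_lt_top.ne
  have hball : ∀ r : ℝ, 0 < r →
      volume (ball (0 : EuclideanSpace ℝ (Fin d)) r) = ENNReal.ofReal (r ^ d) * ω := by
    intro r hr
    rw [Measure.addHaar_ball_of_pos _ _ hr]; simp [hω]
  set b := (volume A / ω).toReal ^ ((d : ℝ)⁻¹) with hb
  have hVω : volume A / ω ≠ ∞ := ENNReal.div_ne_top hAfin hω0
  have hbd : b ^ d = (volume A / ω).toReal := by
    rw [hb, Real.rpow_inv_natCast_pow ENNReal.toReal_nonneg hd]
  have hbA : ENNReal.ofReal (b ^ d) * ω = volume A := by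
    rw [hbd, ENNReal.ofReal_toReal hVω, ENNReal.div_mul_cancel hω0 hωT]
  have hab : a ≤ b := by
    have h1 : a ^ d ≤ b ^ d := by
      rw [hbd, ← ENNReal.ofReal_le_iff_le_toReal hVω, ENNReal.le_div_iff_mul_le (Or.inl hω0)
        (Or.inl hωT), ← hball a ha]
      exact hvol
    exact le_of_pow_le_pow_left₀ hd (by positivity) h1
  have hb0 : 0 < b := ha.trans_le hab
  have hBM := volume_ball_add_le hb0 hε hA hC (by rw [hball b hb0, hbA]) hAC
  refine le_trans ?_ hBM
  rw [hball _ (by positivity), ← hbA, ← add_mul, ← ENNReal.ofReal_add (by positivity)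
    (by positivity)]
  gcongr
  have hbern : b ^ d + d * b ^ (d - 1) * ε ≤ (b + ε) ^ d := by
    have := one_add_mul_le_pow (a := ε / b) (by have : 0 < ε / b := by positivity
                                                linarith) d
    have h2 : (b + ε) ^ d = b ^ d * (1 + ε / b) ^ d := by
      rw [← mul_pow]; congr 1; field_simp
    rw [h2]
    have h3 : b ^ d = b * b ^ (d - 1) := by
      rw [← pow_succ', Nat.sub_add_cancel (Nat.pos_of_ne_zero hd)]
    calc b ^ d + d * b ^ (d - 1) * ε = b ^ d * (1 + d * (ε / b)) := by
          rw [h3]; field_simp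
      _ ≤ _ := by gcongr
  refine le_trans ?_ hbern
  gcongr

/-- A weak form of the coarea formula combined with the isoperimetric inequality. -/
theorem isoperimetric_coarea {d : ℕ} (hd : d ≠ 0) {u : EuclideanSpace ℝ (Fin d) → ℝ}
    {K : NNReal} (hu : LipschitzWith K u) {R : ℝ} (hR : ∀ x, R ≤ ‖x‖ → u x = 0)
    {s t a : ℝ} (hs : 0 ≤ s) (hst : s < t) (ha : 0 < a)
    (hvol : ∀ τ, s ≤ τ → τ < t → volume (ball (0 : EuclideanSpace ℝ (Fin d)) a) ≤
      volume {x | τ < u x}) :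
    ENNReal.ofReal ((t - s) * (d * a ^ (d - 1))) *
      volume (ball (0 : EuclideanSpace ℝ (Fin d)) 1) ≤
      ∫⁻ x in {x | s < u x ∧ u x < t}, ‖fderiv ℝ u x‖ₑ := by
  set ω := volume (ball (0 : EuclideanSpace ℝ (Fin d)) 1) with hω
  set f : EuclideanSpace ℝ (Fin d) → ℝ := fun x => max s (min (u x) t) - s with hf
  have hfL : LipschitzWith K f := by
    have h1 : LipschitzWith K fun x => max s (min (u x) t) :=
      (hu.min_const t).const_max s
    refine LipschitzWith.of_dist_le_mul fun x y => ?_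
    simpa [hf, Real.dist_eq] using h1.dist_le_mul x y
  have hfc := hfL.continuous
  have hfM : ∀ x, f x ≤ t - s := fun x => by
    simp only [hf]; gcongr; exact max_le hst.le (min_le_right _ _)
  have hf0 : ∀ x, 0 ≤ f x := fun x => by
    simp only [hf, sub_nonneg]; exact le_max_left _ _
  have hfR : ∀ x, R ≤ ‖x‖ → f x = 0 := fun x hx => by
    simp only [hf, hR x hx]
    rw [min_eq_left (hs.trans hst.le), max_eq_left hs, sub_self]
  have hflt : ∀ τ, 0 ≤ τ → τ < t - s → {x | τ < f x} = {x | s + τ < u x} := by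
    intro τ h1 h2
    ext x
    simp only [hf, mem_ofPred_eq, lt_sub_iff_add_lt, lt_max_iff, lt_min_iff]
    constructor
    · rintro (h | h)
      · linarith
      · linarith [h.1]
    · intro h; right; exact ⟨by linarith, by linarith⟩
  have hfin : ∀ τ, 0 ≤ τ → volume {x | τ < f x} ≠ ∞ := by
    intro τ hτ
    refine ne_top_of_le_ne_top (measure_ball_lt_top (x := (0 : EuclideanSpace ℝ (Fin d)))
      (r := R)).ne (measure_mono fun x (hx : τ < f x) => ?_)
    rw [mem_ball_zero_iff]
    by_contra h
    rw [hfR x (not_lt.1 h)] at hx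
    linarith
  have hfint : ∫⁻ x, ENNReal.ofReal (f x) ≠ ∞ := by
    refine ne_top_of_le_ne_top (b := ∫⁻ x in ball (0 : EuclideanSpace ℝ (Fin d)) R,
      ENNReal.ofReal (t - s)) ?_ ?_
    · rw [setLIntegral_const]
      exact ENNReal.mul_ne_top ENNReal.ofReal_ne_top measure_ball_lt_top.ne
    · rw [← lintegral_indicator measurableSet_ball]
      refine lintegral_mono fun x => ?_
      by_cases hx : ‖x‖ < R
      · rw [indicator_of_mem (by simpa using hx)]
        exact ENNReal.ofReal_le_ofReal (hfM x)
      · simp [hfR x (not_lt.1 hx)]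
  have key : ∀ ε : ℝ, 0 < ε → ENNReal.ofReal ((t - s) * (d * a ^ (d - 1))) * ω ≤
      ∫⁻ x, ENNReal.ofReal ((ballSup f ε x - f x) / ε) := by
    intro ε hε
    have hmeas := measurable_ballSup hfM hfc hε
    have hlc := lintegral_eq_lintegral_meas_lt volume (f := f) (ae_of_all _ hf0)
      hfc.measurable.aemeasurable
    have hlcS := lintegral_eq_lintegral_meas_lt volume (f := ballSup f ε)
      (ae_of_all _ fun x => (hf0 x).trans (le_ballSup hfM hε x)) hmeas.aemeasurable
    set c := ENNReal.ofReal (d * a ^ (d - 1) * ε) * ω with hc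
    have h1 : (∫⁻ x, ENNReal.ofReal (f x)) + ENNReal.ofReal (t - s) * c ≤
        ∫⁻ x, ENNReal.ofReal (ballSup f ε x) := by
      rw [hlc, hlcS]
      have e1 : ∫⁻ τ in Ioi (0 : ℝ), volume {x | τ < f x} =
          ∫⁻ τ in Ioo (0 : ℝ) (t - s), volume {x | τ < f x} := by
        rw [← Ioo_union_Ici_eq_Ioi (sub_pos.2 hst), lintegral_union measurableSet_Ici (by
          rw [disjoint_left]; intro x hx hx'; exact absurd hx.2 (not_lt.2 hx')),
          setLIntegral_congr_fun (g := fun _ => 0) measurableSet_Ici]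
        · simp
        · intro τ hτ
          have : {x | τ < f x} = ∅ := by
            ext x
            simp only [mem_ofPred_eq, mem_empty_iff_false, iff_false, not_lt]
            exact (hfM x).trans hτ
          simp only [this, measure_empty]
      have e2 : ENNReal.ofReal (t - s) * c = ∫⁻ τ in Ioo (0 : ℝ) (t - s), c := by
        rw [setLIntegral_const, Real.volume_Ioo, sub_zero, mul_comm]
      have hanti : Antitone fun τ : ℝ => volume {x | τ < f x} := fun τ τ' h =>
        measure_mono fun x (hx : τ' < f x) => lt_of_le_of_lt h hx
      rw [e1, e2, ← lintegral_add_left hanti.measurable]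
      refine le_trans (setLIntegral_mono' (g := fun τ => volume {x | τ < ballSup f ε x})
        measurableSet_Ioo fun τ hτ => ?_)
        (lintegral_mono_set Ioo_subset_Ioi_self)
      refine volume_add_le_of_ball_add hd ha hε (measurableSet_lt measurable_const hfc.measurable)
        (isOpen_lt_ballSup hfM hfc hε τ).measurableSet (hfin τ hτ.1.le) ?_ ?_
      · rw [hflt τ hτ.1.le hτ.2]
        exact hvol _ (by linarith [hτ.1]) (by linarith [hτ.2])
      · intro x hx y hy
        exact (lt_ballSup_iff hfM hε).2 ⟨-y, by simpa using hy, by simpa using hx⟩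
    have h2 : ENNReal.ofReal (t - s) * c ≤
        ∫⁻ x, (ENNReal.ofReal (ballSup f ε x) - ENNReal.ofReal (f x)) := by
      rw [lintegral_sub hfc.measurable.ennreal_ofReal hfint
        (ae_of_all _ fun x => ENNReal.ofReal_le_ofReal (le_ballSup hfM hε x))]
      exact ENNReal.le_sub_of_add_le_left hfint h1
    have h3 : ENNReal.ofReal ((t - s) * (d * a ^ (d - 1))) * ω =
        ENNReal.ofReal ε⁻¹ * (ENNReal.ofReal (t - s) * c) := by
      rw [hc, show (t - s) * (d * a ^ (d - 1)) = ε⁻¹ * ((t - s) * (d * a ^ (d - 1) * ε)) by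
        field_simp, ENNReal.ofReal_mul (by positivity), ENNReal.ofReal_mul (sub_pos.2 hst).le,
        mul_assoc, mul_assoc]
    rw [h3]
    refine le_trans (mul_le_mul_right h2 _) (le_of_eq ?_)
    rw [← lintegral_const_mul' _ _ ENNReal.ofReal_ne_top]
    refine lintegral_congr fun x => ?_
    rw [← ENNReal.ofReal_sub _ (hf0 x), ← ENNReal.ofReal_mul (by positivity)]
    congr 1
    rw [div_eq_inv_mul]
  set e : ℕ → ℝ := fun n => 1 / ((n : ℝ) + 1) with he
  have he0 : ∀ n, 0 < e n := fun n => by simp only [he]; positivity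
  have he1 : ∀ n, e n ≤ 1 := fun n => by
    simp only [he]
    rw [div_le_one (by positivity)]
    linarith [Nat.cast_nonneg (α := ℝ) n]
  have helim : Tendsto e atTop (nhds 0) := tendsto_one_div_add_atTop_nhds_zero_nat
  have hFatou := limsup_lintegral_le (μ := (volume : Measure (EuclideanSpace ℝ (Fin d))))
    (f := fun n x => ENNReal.ofReal ((ballSup f (e n) x - f x) / e n))
    ((ball (0 : EuclideanSpace ℝ (Fin d)) (R + 1)).indicator fun _ => (K : ℝ≥0∞))
    (fun n => (((measurable_ballSup hfM hfc (he0 n)).sub hfc.measurable).div_const _).ennreal_ofReal)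
    (fun n => ae_of_all _ fun x => by
      by_cases hx : ‖x‖ < R + 1
      · rw [indicator_of_mem (by simpa using hx), ← ENNReal.ofReal_coe_nnreal]
        apply ENNReal.ofReal_le_ofReal
        rw [div_le_iff₀ (he0 n), sub_le_iff_le_add]
        refine ballSup_le (he0 n) fun y hy => ?_
        have h1 := hfL.dist_le_mul (x + y) x
        rw [Real.dist_eq, dist_eq_norm, add_sub_cancel_left] at h1
        have h2 := (le_abs_self _).trans h1
        have h3 : (K : ℝ) * ‖y‖ ≤ K * e n := by gcongr
        linarith
      · have : ballSup f (e n) x ≤ 0 := by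
          refine ballSup_le (he0 n) fun y hy => ?_
          rw [hfR]
          have := norm_sub_le (x + y) y
          rw [add_sub_cancel_right] at this
          linarith [he1 n]
        dsimp only
        rw [ENNReal.ofReal_of_nonpos]
        · simp
        · exact div_nonpos_of_nonpos_of_nonneg (by linarith [hf0 x]) (he0 n).le)
    (by
      rw [lintegral_indicator_const measurableSet_ball]
      exact ENNReal.mul_ne_top ENNReal.coe_ne_top measure_ball_lt_top.ne)
  have hL : ENNReal.ofReal ((t - s) * (d * a ^ (d - 1))) * ω ≤
      limsup (fun n => ∫⁻ x, ENNReal.ofReal ((ballSup f (e n) x - f x) / e n)) atTop := by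
    refine le_limsup_of_frequently_le (Frequently.of_forall fun n => key _ (he0 n))
      (by isBoundedDefault)
  refine hL.trans (hFatou.trans ?_)
  have hS : MeasurableSet {x | s < u x ∧ u x < t} :=
    ((isOpen_lt continuous_const hu.continuous).inter
      (isOpen_lt hu.continuous continuous_const)).measurableSet
  rw [← lintegral_indicator hS]
  refine lintegral_mono_ae ?_
  filter_upwards [hfL.ae_differentiableAt] with x hx
  refine (limsup_ballSup_le hx he0 helim).trans (le_of_eq ?_)
  have : fderiv ℝ f x = fderiv ℝ (fun x => max s (min (u x) t)) x := by
    simp only [hf]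
    rw [fderiv_sub_const]
  rw [this, fderiv_clamp hu.continuous]
  by_cases h : x ∈ {x | s < u x ∧ u x < t}
  · rw [indicator_of_mem h, indicator_of_mem h]
  · rw [indicator_of_notMem h, indicator_of_notMem h, ← ofReal_norm, norm_zero, ENNReal.ofReal_zero]

theorem isoperimetric_coarea_sq {d : ℕ} (hd : d ≠ 0) {u : EuclideanSpace ℝ (Fin d) → ℝ}
    {K : NNReal} (hu : LipschitzWith K u) {R : ℝ} (hR : ∀ x, R ≤ ‖x‖ → u x = 0)
    {s t a : ℝ} (hs : 0 ≤ s) (hst : s < t) (ha : 0 < a)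
    (hvol : ∀ τ, s ≤ τ → τ < t → volume (ball (0 : EuclideanSpace ℝ (Fin d)) a) ≤
      volume {x | τ < u x}) :
    (ENNReal.ofReal ((t - s) * (d * a ^ (d - 1))) *
      volume (ball (0 : EuclideanSpace ℝ (Fin d)) 1)) ^ 2 ≤
      volume {x | s < u x ∧ u x < t} *
      ∫⁻ x in {x | s < u x ∧ u x < t}, ‖fderiv ℝ u x‖ₑ ^ 2 := by
  refine le_trans (pow_le_pow_left' (isoperimetric_coarea hd hu hR hs hst ha hvol) 2) ?_
  set S := {x | s < u x ∧ u x < t}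
  have hm : Measurable fun x => ‖fderiv ℝ u x‖ₑ := (measurable_fderiv ℝ u).enorm
  have h := ENNReal.lintegral_mul_le_Lp_mul_Lq (volume.restrict S) Real.HolderConjugate.two_two
    (f := fun _ => (1 : ℝ≥0∞)) (g := fun x => ‖fderiv ℝ u x‖ₑ) aemeasurable_const hm.aemeasurable
  simp only [Pi.mul_apply, one_mul, lintegral_const, Measure.restrict_apply,
    MeasurableSet.univ, univ_inter, ENNReal.rpow_ofNat] at h
  refine le_trans (pow_le_pow_left' h 2) (le_of_eq ?_)
  have hX : ∀ X : ℝ≥0∞, (X ^ (1 / 2 : ℝ)) ^ 2 = X := fun X => by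
    rw [← ENNReal.rpow_natCast, ← ENNReal.rpow_mul]; norm_num
  rw [one_pow, one_mul, mul_pow, hX, hX]

/-- The volume of the unit ball, as a real number. -/
def unitBallVol (d : ℕ) : ℝ := volume.real (ball (0 : EuclideanSpace ℝ (Fin d)) 1)

theorem unitBallVol_pos (d : ℕ) : 0 < unitBallVol d :=
  ENNReal.toReal_pos (measure_ball_pos _ _ one_pos).ne' measure_ball_lt_top.ne

theorem ofReal_unitBallVol (d : ℕ) : ENNReal.ofReal (unitBallVol d) =
    volume (ball (0 : EuclideanSpace ℝ (Fin d)) 1) :=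
  ENNReal.ofReal_toReal measure_ball_lt_top.ne

theorem volume_ball_eq_ofReal {d : ℕ} {r : ℝ} (hr : 0 < r) :
    volume (ball (0 : EuclideanSpace ℝ (Fin d)) r) = ENNReal.ofReal (unitBallVol d * r ^ d) := by
  rw [Measure.addHaar_ball_of_pos _ _ hr, mul_comm (unitBallVol d), ENNReal.ofReal_mul
    (by positivity), ofReal_unitBallVol]
  simp

/-- The decreasing rearrangement of `u`, as a function of the `d`-th power of the radius. -/
def profile {d : ℕ} (u : EuclideanSpace ℝ (Fin d) → ℝ) (s : ℝ) : ℝ :=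
  sSup (insert 0 {t | 0 ≤ t ∧ unitBallVol d * max s 0 < volume.real {x | t < u x}})

/-- The square of the isoperimetric weight. -/
def isoWeight (d : ℕ) (s : ℝ) : ℝ := (d * (s ^ (d : ℝ)⁻¹) ^ (d - 1)) ^ 2

section profile

variable {d : ℕ} {u : EuclideanSpace ℝ (Fin d) → ℝ} {K : NNReal} {R : ℝ}

theorem volume_superlevel_ne_top (hR : ∀ x, R ≤ ‖x‖ → u x = 0) {t : ℝ} (ht : 0 ≤ t) :
    volume {x | t < u x} ≠ ∞ := by
  refine ne_top_of_le_ne_top (measure_ball_lt_top (x := (0 : EuclideanSpace ℝ (Fin d)))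
    (r := R)).ne (measure_mono fun x (hx : t < u x) => ?_)
  rw [mem_ball_zero_iff]
  by_contra h
  rw [hR x (not_lt.1 h)] at hx
  linarith

theorem volume_superlevel_anti (hR : ∀ x, R ≤ ‖x‖ → u x = 0) {t t' : ℝ} (ht : 0 ≤ t)
    (htt : t ≤ t') : volume.real {x | t' < u x} ≤ volume.real {x | t < u x} :=
  measureReal_mono (fun _ (hx : t' < _) => lt_of_le_of_lt htt hx) (volume_superlevel_ne_top hR ht)

theorem exists_bound (hu : LipschitzWith K u) (hR : ∀ x, R ≤ ‖x‖ → u x = 0) :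
    ∃ M, 0 ≤ M ∧ ∀ x, u x ≤ M := by
  obtain ⟨M, hM⟩ := (isCompact_closedBall (0 : EuclideanSpace ℝ (Fin d)) R).bddAbove_image
    hu.continuous.continuousOn
  refine ⟨max M 0, le_max_right _ _, fun x => ?_⟩
  rcases le_or_gt R ‖x‖ with h | h
  · rw [hR x h]; exact le_max_right _ _
  · exact (hM ⟨x, by simpa using h.le, rfl⟩).trans (le_max_left _ _)

theorem exists_lt_superlevel (hR : ∀ x, R ≤ ‖x‖ → u x = 0) {t c : ℝ} (ht : 0 ≤ t)
    (hc : c < volume.real {x | t < u x}) : ∃ t' > t, c < volume.real {x | t' < u x} := by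
  have hU : {x | t < u x} = ⋃ n : ℕ, {x | t + 1 / ((n : ℝ) + 1) < u x} := by
    ext x
    simp only [mem_ofPred_eq, mem_iUnion]
    constructor
    · intro h
      obtain ⟨n, hn⟩ := exists_nat_one_div_lt (sub_pos.2 h)
      exact ⟨n, by linarith⟩
    · rintro ⟨n, hn⟩
      have : (0 : ℝ) < 1 / ((n : ℝ) + 1) := by positivity
      linarith
  have hmono : Monotone fun n : ℕ => {x | t + 1 / ((n : ℝ) + 1) < u x} := by
    intro m n hmn x hx
    have : 1 / ((n : ℝ) + 1) ≤ 1 / ((m : ℝ) + 1) := by gcongr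
    simp only [mem_ofPred_eq] at hx ⊢
    linarith
  have hlim := tendsto_measure_iUnion_atTop (μ := volume) hmono
  rw [← hU] at hlim
  have hlim' := (ENNReal.tendsto_toReal (volume_superlevel_ne_top hR ht)).comp hlim
  obtain ⟨n, hn⟩ := (hlim'.eventually (lt_mem_nhds hc)).exists
  exact ⟨t + 1 / ((n : ℝ) + 1), by simp only [gt_iff_lt, lt_add_iff_pos_right]; positivity, hn⟩

theorem bddAbove_profile (hu : LipschitzWith K u) (hR : ∀ x, R ≤ ‖x‖ → u x = 0) (s : ℝ) :
    BddAbove (insert 0 {t | 0 ≤ t ∧ unitBallVol d * max s 0 < volume.real {x | t < u x}}) := by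
  obtain ⟨M, hM0, hM⟩ := exists_bound hu hR
  refine ⟨M, ?_⟩
  rintro t (rfl | ⟨ht, h⟩)
  · exact hM0
  · by_contra hlt
    have : {x | t < u x} = ∅ := by
      ext x; simp only [mem_ofPred_eq, mem_empty_iff_false, iff_false, not_lt]
      exact (hM x).trans (not_le.1 hlt).le
    rw [this, measureReal_empty] at h
    exact absurd h (not_lt.2 (mul_nonneg (unitBallVol_pos d).le (le_max_right _ _)))

theorem profile_nonneg (hu : LipschitzWith K u) (hR : ∀ x, R ≤ ‖x‖ → u x = 0) (s : ℝ) :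
    0 ≤ profile u s :=
  le_csSup (bddAbove_profile hu hR s) (mem_insert _ _)

theorem lt_profile_iff (hu : LipschitzWith K u) (hR : ∀ x, R ≤ ‖x‖ → u x = 0) {s t : ℝ}
    (hs : 0 ≤ s) (ht : 0 ≤ t) :
    t < profile u s ↔ unitBallVol d * s < volume.real {x | t < u x} := by
  constructor
  · intro h
    obtain ⟨t', h1 | ⟨h1, h2⟩, h3⟩ := exists_lt_of_lt_csSup (insert_nonempty _ _) h
    · subst h1; linarith
    · rw [max_eq_left hs] at h2
      exact h2.trans_le (volume_superlevel_anti hR ht h3.le)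
  · intro h
    obtain ⟨t', h1, h2⟩ := exists_lt_superlevel hR ht h
    refine lt_of_lt_of_le h1 (le_csSup (bddAbove_profile hu hR s) (Or.inr ⟨?_, ?_⟩))
    · exact ht.trans h1.le
    · rwa [max_eq_left hs]

theorem profile_antitone (hu : LipschitzWith K u) (hR : ∀ x, R ≤ ‖x‖ → u x = 0) :
    Antitone (profile u) := by
  intro s s' h
  refine csSup_le_csSup (bddAbove_profile hu hR s) (insert_nonempty _ _)
    (insert_subset_insert fun t ht => ⟨ht.1, lt_of_le_of_lt ?_ ht.2⟩)
  exact mul_le_mul_of_nonneg_left (max_le_max_right _ h) (unitBallVol_pos d).le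

theorem profile_eq_zero (hu : LipschitzWith K u) (hR : ∀ x, R ≤ ‖x‖ → u x = 0) {s : ℝ}
    (hs : 0 ≤ s) (h : volume.real {x | 0 < u x} ≤ unitBallVol d * s) : profile u s = 0 := by
  refine le_antisymm (not_lt.1 fun h1 => ?_) (profile_nonneg hu hR s)
  exact absurd ((lt_profile_iff hu hR hs le_rfl).1 h1) (not_lt.2 h)

theorem volume_superlevel_profile_le (hu : LipschitzWith K u) (hR : ∀ x, R ≤ ‖x‖ → u x = 0)
    {s : ℝ} (hs : 0 ≤ s) : volume.real {x | profile u s < u x} ≤ unitBallVol d * s :=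
  not_lt.1 fun h => lt_irrefl _ ((lt_profile_iff hu hR hs (profile_nonneg hu hR s)).2 h)

theorem profile_pow_sub_le (hd : d ≠ 0) (hu : LipschitzWith K u)
    (hR : ∀ x, R ≤ ‖x‖ → u x = 0) {r r' : ℝ} (hr : 0 ≤ r) (hrr : r < r') :
    profile u (r ^ d) - profile u (r' ^ d) ≤ K * (r' - r) := by
  by_contra! hlt
  have hω := unitBallVol_pos d
  set t' := profile u (r' ^ d) with ht'
  have ht0 : 0 ≤ t' := profile_nonneg hu hR _
  set t := t' + K * (r' - r) with ht
  have hε : 0 < r' - r := sub_pos.2 hrr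
  have ht00 : 0 ≤ t := by positivity
  have h1 : t < profile u (r ^ d) := by linarith
  rw [lt_profile_iff hu hR (by positivity) ht00] at h1
  set Vt := volume.real {x | t < u x} with hV
  set a := (Vt / unitBallVol d) ^ (d : ℝ)⁻¹ with ha
  have hVn : 0 ≤ Vt := measureReal_nonneg
  have had : a ^ d = Vt / unitBallVol d := Real.rpow_inv_natCast_pow (by positivity) hd
  have har : r < a := by
    refine lt_of_pow_lt_pow_left₀ d (by positivity) ?_
    rw [had, lt_div_iff₀ hω]; linarith
  have ha0 : 0 < a := hr.trans_lt har
  have hBM := volume_ball_add_le (A := {x | t < u x}) (C := {x | t' < u x}) ha0 hε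
    (measurableSet_lt measurable_const hu.continuous.measurable)
    (measurableSet_lt measurable_const hu.continuous.measurable)
    (by
      rw [volume_ball_eq_ofReal ha0, had, mul_div_cancel₀ _ hω.ne', hV]
      rw [ofReal_measureReal (volume_superlevel_ne_top hR ht00)])
    (by
      intro x hx y hy
      have h1 := hu.dist_le_mul x (x + y)
      rw [Real.dist_eq, dist_self_add_right] at h1
      have h2 := (le_abs_self _).trans h1
      have h3 : (K : ℝ) * ‖y‖ ≤ K * (r' - r) := by gcongr
      simp only [mem_ofPred_eq] at hx ⊢
      linarith)
  rw [volume_ball_eq_ofReal (by positivity), ENNReal.ofReal_le_iff_le_toReal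
    (volume_superlevel_ne_top hR ht0)] at hBM
  have h2 : t' < profile u (r' ^ d) := by
    rw [lt_profile_iff hu hR (pow_nonneg (hr.trans hrr.le) d) ht0]
    have hpow : r' ^ d < (a + (r' - r)) ^ d :=
      pow_lt_pow_left₀ (by linarith) (hr.trans hrr.le) hd
    exact lt_of_lt_of_le (mul_lt_mul_of_pos_left hpow hω) hBM
  exact lt_irrefl _ h2

theorem lintegral_profile_rpow (hu : LipschitzWith K u) (hR : ∀ x, R ≤ ‖x‖ → u x = 0)
    (hu0 : ∀ x, 0 ≤ u x) {p : ℝ} (hp : 0 < p) :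
    ENNReal.ofReal (unitBallVol d) * ∫⁻ s in Ioi (0 : ℝ), ENNReal.ofReal (profile u s ^ p) =
      ∫⁻ x, ENNReal.ofReal (u x ^ p) := by
  rw [lintegral_rpow_eq_lintegral_meas_lt_mul (volume.restrict (Ioi (0 : ℝ)))
    (ae_of_all _ (profile_nonneg hu hR)) (profile_antitone hu hR).measurable.aemeasurable hp,
    lintegral_rpow_eq_lintegral_meas_lt_mul volume (ae_of_all _ hu0)
    hu.continuous.measurable.aemeasurable hp, mul_left_comm,
    ← lintegral_const_mul' _ _ ENNReal.ofReal_ne_top]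
  congr 1
  refine setLIntegral_congr_fun measurableSet_Ioi fun t ht => ?_
  have hω := unitBallVol_pos d
  rw [← mul_assoc]
  congr 1
  have ht0 : 0 ≤ t := le_of_lt ht
  have : {s | t < profile u s} ∩ Ioi 0 = Ioo 0 (volume.real {x | t < u x} / unitBallVol d) := by
    ext s
    simp only [mem_inter_iff, mem_ofPred_eq, mem_Ioi, mem_Ioo]
    constructor
    · rintro ⟨h1, h2⟩
      rw [lt_profile_iff hu hR h2.le ht0] at h1
      exact ⟨h2, by rw [lt_div_iff₀ hω]; linarith⟩
    · rintro ⟨h1, h2⟩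
      rw [lt_div_iff₀ hω] at h2
      exact ⟨(lt_profile_iff hu hR h1.le ht0).2 (by linarith), h1⟩
  rw [Measure.restrict_apply (measurableSet_lt measurable_const
    (profile_antitone hu hR).measurable), this, Real.volume_Ioo, sub_zero,
    ← ENNReal.ofReal_mul hω.le, mul_div_cancel₀ _ hω.ne',
    ofReal_measureReal (volume_superlevel_ne_top hR ht0)]

theorem lintegral_fderiv_sq_ne_top (hu : LipschitzWith K u) (hR : ∀ x, R ≤ ‖x‖ → u x = 0) :
    ∫⁻ x, ‖fderiv ℝ u x‖ₑ ^ 2 ≠ ∞ := by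
  refine ne_top_of_le_ne_top (b := ∫⁻ x in closedBall (0 : EuclideanSpace ℝ (Fin d)) R,
      (K : ℝ≥0∞) ^ 2) ?_ ?_
  · rw [setLIntegral_const]
    exact ENNReal.mul_ne_top (by simp) measure_closedBall_lt_top.ne
  · rw [← lintegral_indicator measurableSet_closedBall]
    refine lintegral_mono fun x => ?_
    by_cases hx : ‖x‖ ≤ R
    · rw [indicator_of_mem (by simpa using hx)]
      gcongr
      rw [enorm_le_coe]
      exact norm_fderiv_le_of_lipschitz ℝ hu
    · have : fderiv ℝ u x = 0 := by
        have h : u =ᶠ[nhds x] fun _ => 0 := by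
          filter_upwards [(isOpen_lt continuous_const continuous_norm).mem_nhds (not_le.1 hx)]
            with y hy using hR y (le_of_lt hy)
        rw [h.fderiv_eq]; simp
      rw [this, ← ofReal_norm, norm_zero]
      simp

theorem sq_profile_sub_mul_le (hd : d ≠ 0) (hu : LipschitzWith K u)
    (hR : ∀ x, R ≤ ‖x‖ → u x = 0) {s₁ s₂ : ℝ} (hs₁ : 0 < s₁) (hs : s₁ < s₂) :
    (profile u s₁ - profile u s₂) ^ 2 * (unitBallVol d * isoWeight d s₁) ≤
      (s₂ - s₁) * ((∫⁻ x in {x | profile u s₂ < u x}, ‖fderiv ℝ u x‖ₑ ^ 2).toReal -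
        (∫⁻ x in {x | profile u s₁ < u x}, ‖fderiv ℝ u x‖ₑ ^ 2).toReal) := by
  have hω := unitBallVol_pos d
  have hfin : ∀ A : Set (EuclideanSpace ℝ (Fin d)), ∫⁻ x in A, ‖fderiv ℝ u x‖ₑ ^ 2 ≠ ∞ :=
    fun A => ne_top_of_le_ne_top (lintegral_fderiv_sq_ne_top hu hR)
      (setLIntegral_le_lintegral _ _)
  have hmeas : ∀ t, MeasurableSet {x | t < u x} := fun t =>
    measurableSet_lt measurable_const hu.continuous.measurable
  set t := profile u s₁ with ht
  set s := profile u s₂ with hs'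
  have hst : s ≤ t := profile_antitone hu hR hs.le
  have hs0 : 0 ≤ s := profile_nonneg hu hR _
  set Φ : ℝ → ℝ := fun t => (∫⁻ x in {x | t < u x}, ‖fderiv ℝ u x‖ₑ ^ 2).toReal with hΦ
  change _ ≤ (s₂ - s₁) * (Φ s - Φ t)
  rcases hst.eq_or_lt with heq | hlt
  · rw [← heq]; simp
  have key : ∀ τ ∈ Ioo s t, (τ - s) ^ 2 * (unitBallVol d * isoWeight d s₁) ≤
      (s₂ - s₁) * (Φ s - Φ t) := by
    intro τ hτ
    set a := s₁ ^ (d : ℝ)⁻¹ with ha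
    have ha0 : 0 < a := by positivity
    have had : a ^ d = s₁ := Real.rpow_inv_natCast_pow hs₁.le hd
    have h := isoperimetric_coarea_sq hd hu hR hs0 hτ.1 ha0 (fun σ h1 h2 => by
      have := (lt_profile_iff hu hR hs₁.le (hs0.trans h1)).1 (h2.trans hτ.2)
      rw [volume_ball_eq_ofReal ha0, had, ENNReal.ofReal_le_iff_le_toReal
        (volume_superlevel_ne_top hR (hs0.trans h1))]
      exact this.le)
    set S := {x | s < u x ∧ u x < τ} with hS
    have hSm : MeasurableSet S := (hmeas s).inter
      (measurableSet_lt hu.continuous.measurable measurable_const)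
    have hSs : S ⊆ {x | s < u x} := fun x hx => hx.1
    have hvS : volume S ≠ ∞ := ne_top_of_le_ne_top (volume_superlevel_ne_top hR hs0)
      (measure_mono hSs)
    have h1 := ENNReal.toReal_mono (ENNReal.mul_ne_top hvS (hfin S)) h
    rw [ENNReal.toReal_mul, ENNReal.toReal_pow, ENNReal.toReal_mul, ENNReal.toReal_ofReal
      (by have := sub_pos.2 hτ.1; positivity)] at h1
    change ((τ - s) * (d * a ^ (d - 1)) * unitBallVol d) ^ 2 ≤ volume.real S * _ at h1
    have h2 : volume.real S ≤ unitBallVol d * (s₂ - s₁) := by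
      have e1 : volume.real S + volume.real {x | τ < u x} ≤ volume.real {x | s < u x} := by
        have hdisj : Disjoint S {x | τ < u x} :=
          disjoint_left.2 fun x hx hx' => lt_asymm hx.2 hx'
        rw [← measureReal_union hdisj (hmeas τ) hvS (volume_superlevel_ne_top hR (hs0.trans hτ.1.le))]
        refine measureReal_mono (union_subset hSs fun x (hx : τ < u x) => hτ.1.trans hx)
          (volume_superlevel_ne_top hR hs0)
      have e2 := volume_superlevel_profile_le hu hR (hs₁.trans hs).le
      have e3 := (lt_profile_iff hu hR hs₁.le (hs0.trans hτ.1.le)).1 hτ.2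
      rw [← hs'] at e2
      linarith
    have h3 : (∫⁻ x in S, ‖fderiv ℝ u x‖ₑ ^ 2).toReal ≤ Φ s - Φ t := by
      rw [le_sub_iff_add_le, hΦ]
      dsimp only
      have hdisj : Disjoint S {x | t < u x} :=
        disjoint_left.2 fun x hx hx' => lt_asymm (hx.2.trans hτ.2) hx'
      rw [← ENNReal.toReal_add (hfin _) (hfin _), ← lintegral_union (hmeas t) hdisj]
      exact ENNReal.toReal_mono (hfin _) (lintegral_mono_set
        (union_subset hSs fun x (hx : t < u x) => hlt.trans hx))
    have h4 := h1.trans (mul_le_mul h2 h3 ENNReal.toReal_nonneg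
      (mul_nonneg hω.le (sub_pos.2 hs).le))
    refine le_of_mul_le_mul_left ?_ hω
    calc _ = ((τ - s) * (d * a ^ (d - 1)) * unitBallVol d) ^ 2 := by
          rw [isoWeight]; ring
      _ ≤ _ := h4
      _ = _ := by ring
  have hlim : Tendsto (fun τ => (τ - s) ^ 2 * (unitBallVol d * isoWeight d s₁))
      (nhdsWithin t (Iio t)) (nhds ((t - s) ^ 2 * (unitBallVol d * isoWeight d s₁))) := by
    apply Tendsto.mono_left _ nhdsWithin_le_nhds
    exact Continuous.tendsto (by fun_prop) t
  refine le_of_tendsto hlim ?_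
  filter_upwards [Ioo_mem_nhdsLT hlt] with τ hτ using key τ hτ

theorem lintegral_deriv_le_of_monotone {Φ : ℝ → ℝ} (hΦ : Monotone Φ) {a b : ℝ} (hab : a ≤ b) :
    ∫⁻ s in Ioo a b, ENNReal.ofReal (deriv Φ s) ≤ ENNReal.ofReal (Φ b - Φ a) := by
  have h1 := MonotoneOn.intervalIntegrable_deriv (a := a) (b := b) (hΦ.monotoneOn _)
  have h2 := MonotoneOn.intervalIntegral_deriv_mem_uIcc (a := a) (b := b) (hΦ.monotoneOn _)
  rw [intervalIntegrable_iff_integrableOn_Ioo_of_le hab] at h1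
  rw [intervalIntegral.integral_of_le hab, integral_Ioc_eq_integral_Ioo,
    uIcc_of_le (sub_nonneg.2 (hΦ hab))] at h2
  rw [← ofReal_integral_eq_lintegral_ofReal h1 (ae_of_all _ fun x => hΦ.deriv_nonneg)]
  exact ENNReal.ofReal_le_ofReal h2.2

/-- The Pólya–Szegő inequality. -/
theorem lintegral_deriv_profile_le (hd : d ≠ 0) (hu : LipschitzWith K u)
    (hR : ∀ x, R ≤ ‖x‖ → u x = 0) (S : ℝ) :
    ∫⁻ s in Ioo 0 S, ENNReal.ofReal (unitBallVol d * (isoWeight d s * deriv (profile u) s ^ 2)) ≤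
      ∫⁻ x, ‖fderiv ℝ u x‖ₑ ^ 2 := by
  rcases le_total S 0 with hS | hS
  · rw [Ioo_eq_empty (not_lt.2 hS)]; simp
  have hfin : ∀ A : Set (EuclideanSpace ℝ (Fin d)), ∫⁻ x in A, ‖fderiv ℝ u x‖ₑ ^ 2 ≠ ∞ :=
    fun A => ne_top_of_le_ne_top (lintegral_fderiv_sq_ne_top hu hR)
      (setLIntegral_le_lintegral _ _)
  set Φ : ℝ → ℝ := fun s => (∫⁻ x in {x | profile u s < u x}, ‖fderiv ℝ u x‖ₑ ^ 2).toReal with hΦ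
  have hΦm : Monotone Φ := fun s s' h => ENNReal.toReal_mono (hfin _) (lintegral_mono_set
    fun x (hx : profile u s < u x) => (profile_antitone hu hR h).trans_lt hx)
  calc _ ≤ ∫⁻ s in Ioo 0 S, ENNReal.ofReal (deriv Φ s) := ?_
    _ ≤ _ := lintegral_deriv_le_of_monotone hΦm hS
    _ ≤ ENNReal.ofReal (Φ S) := ENNReal.ofReal_le_ofReal
      (sub_le_self _ ENNReal.toReal_nonneg)
    _ ≤ _ := by
      rw [hΦ, ENNReal.ofReal_toReal (hfin _)]
      exact setLIntegral_le_lintegral _ _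
  refine setLIntegral_mono_ae' measurableSet_Ioo ?_
  filter_upwards [hΦm.ae_differentiableAt, (profile_antitone hu hR).neg.ae_differentiableAt]
    with s h1 h2 hs
  apply ENNReal.ofReal_le_ofReal
  have h2' : DifferentiableAt ℝ (profile u) s := by simpa using h2.neg
  have l1 := (hasDerivAt_iff_tendsto_slope.1 h1.hasDerivAt).mono_left
    (nhdsWithin_mono s (show Ioi s ⊆ {s}ᶜ from fun x hx => ne_of_gt hx))
  have l2 := (hasDerivAt_iff_tendsto_slope.1 h2'.hasDerivAt).mono_left
    (nhdsWithin_mono s (show Ioi s ⊆ {s}ᶜ from fun x hx => ne_of_gt hx))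
  have l3 := ((l2.pow 2).const_mul (isoWeight d s)).const_mul (unitBallVol d)
  refine le_of_tendsto_of_tendsto l3 l1 ?_
  filter_upwards [self_mem_nhdsWithin] with s' hs'
  have hpos : 0 < s' - s := sub_pos.2 hs'
  have := sq_profile_sub_mul_le hd hu hR hs.1 hs'
  change _ ≤ (s' - s) * (Φ s' - Φ s) at this
  rw [slope_def_field, slope_def_field, div_pow, le_div_iff₀ hpos]
  calc _ = (profile u s - profile u s') ^ 2 * (unitBallVol d * isoWeight d s) / (s' - s) := by
        field_simp; ring
    _ ≤ _ := by rw [div_le_iff₀ hpos]; linarith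

end profile

theorem map_norm_pow_volume {d : ℕ} (hd : d ≠ 0) :
    Measure.map (fun x : EuclideanSpace ℝ (Fin d) => ‖x‖ ^ d) volume =
      ENNReal.ofReal (unitBallVol d) • volume.restrict (Ioi (0 : ℝ)) := by
  have hω := unitBallVol_pos d
  have hm : Measurable fun x : EuclideanSpace ℝ (Fin d) => ‖x‖ ^ d := by fun_prop
  have hroot : ∀ c : ℝ, 0 ≤ c → (c ^ (d : ℝ)⁻¹) ^ d = c := fun c hc =>
    Real.rpow_inv_natCast_pow hc hd
  have hlt : ∀ b : ℝ, 0 ≤ b → volume {x : EuclideanSpace ℝ (Fin d) | ‖x‖ ^ d < b} =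
      ENNReal.ofReal (unitBallVol d * b) := by
    intro b hb
    rcases hb.eq_or_lt with rfl | hb'
    · have : {x : EuclideanSpace ℝ (Fin d) | ‖x‖ ^ d < 0} = ∅ := by
        ext x; simp only [mem_ofPred_eq, mem_empty_iff_false, iff_false, not_lt]; positivity
      rw [this]; simp
    · have h0 : 0 < b ^ (d : ℝ)⁻¹ := by positivity
      rw [← hroot b hb, ← volume_ball_eq_ofReal h0]
      congr 1
      ext x
      rw [mem_ball_zero_iff, mem_ofPred_eq, pow_lt_pow_iff_left₀ (norm_nonneg _) h0.le hd]
  have hle : ∀ a : ℝ, 0 ≤ a → volume {x : EuclideanSpace ℝ (Fin d) | ‖x‖ ^ d ≤ a} =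
      ENNReal.ofReal (unitBallVol d * a) := by
    intro a ha
    refine le_antisymm ?_ ?_
    · have hlim : Tendsto (fun b => ENNReal.ofReal (unitBallVol d * b)) (nhdsWithin a (Ioi a))
          (nhds (ENNReal.ofReal (unitBallVol d * a))) := by
        apply Tendsto.mono_left _ nhdsWithin_le_nhds
        exact (ENNReal.continuous_ofReal.comp (continuous_const_mul (unitBallVol d))).tendsto a
      refine ge_of_tendsto hlim ?_
      filter_upwards [self_mem_nhdsWithin] with b hb
      rw [← hlt b (ha.trans (le_of_lt hb))]
      exact measure_mono fun x (hx : ‖x‖ ^ d ≤ a) => lt_of_le_of_lt hx hb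
    · rw [← hlt a ha]
      exact measure_mono fun x (hx : ‖x‖ ^ d < a) => le_of_lt hx
  have hIoo : ∀ a b : ℝ, 0 ≤ a → a ≤ b →
      volume {x : EuclideanSpace ℝ (Fin d) | a < ‖x‖ ^ d ∧ ‖x‖ ^ d < b} =
      ENNReal.ofReal (unitBallVol d * (b - a)) := by
    intro a b ha hab
    rcases hab.eq_or_lt with rfl | hab
    · have : {x : EuclideanSpace ℝ (Fin d) | a < ‖x‖ ^ d ∧ ‖x‖ ^ d < a} = ∅ := by
        ext x; simp only [mem_ofPred_eq, mem_empty_iff_false, iff_false]; rintro ⟨h1, h2⟩; linarith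
      rw [this]; simp
    have : {x : EuclideanSpace ℝ (Fin d) | a < ‖x‖ ^ d ∧ ‖x‖ ^ d < b} =
        {x | ‖x‖ ^ d < b} \ {x | ‖x‖ ^ d ≤ a} := by
      ext x; simp only [mem_ofPred_eq, Set.mem_sdiff, not_le, and_comm]
    have hsub : {x : EuclideanSpace ℝ (Fin d) | ‖x‖ ^ d ≤ a} ⊆ {x | ‖x‖ ^ d < b} :=
      fun x hx => lt_of_le_of_lt hx hab
    have hms : MeasurableSet {x : EuclideanSpace ℝ (Fin d) | ‖x‖ ^ d ≤ a} :=
      measurableSet_le hm measurable_const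
    rw [this, measure_sdiff hsub hms.nullMeasurableSet (by rw [hle a ha]; simp), hle a ha,
      hlt b (ha.trans hab.le), ← ENNReal.ofReal_sub _ (by positivity), mul_sub]
  have hpre : ∀ a b : ℝ, Measure.map (fun x : EuclideanSpace ℝ (Fin d) => ‖x‖ ^ d) volume
      (Ioo a b) = volume {x : EuclideanSpace ℝ (Fin d) | a < ‖x‖ ^ d ∧ ‖x‖ ^ d < b} := fun a b => by
    rw [Measure.map_apply hm measurableSet_Ioo]; rfl
  have hloc : IsLocallyFiniteMeasure
      (Measure.map (fun x : EuclideanSpace ℝ (Fin d) => ‖x‖ ^ d) volume) := by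
    refine ⟨fun s => ⟨Ioo (s - 1) (s + 1), Ioo_mem_nhds (by linarith) (by linarith), ?_⟩⟩
    rw [hpre]
    refine lt_of_le_of_lt (measure_mono (t := {x | ‖x‖ ^ d < max (s + 1) 0})
      fun x hx => lt_of_lt_of_le hx.2 (le_max_left _ _)) ?_
    rw [hlt _ (le_max_right _ _)]
    exact ENNReal.ofReal_lt_top
  refine Real.measure_ext_Ioo_rat fun p q => ?_
  rw [hpre, Measure.smul_apply, Measure.restrict_apply measurableSet_Ioo, smul_eq_mul]
  rcases le_or_gt (q : ℝ) (max p 0) with h | h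
  · have e1 : Ioo (p : ℝ) q ∩ Ioi 0 = ∅ := by
      ext s
      simp only [mem_inter_iff, mem_Ioo, mem_Ioi, mem_empty_iff_false, iff_false]
      rintro ⟨⟨h1, h2⟩, h3⟩
      exact absurd (max_lt h1 h3) (not_lt.2 (h2.le.trans h))
    rw [e1, measure_empty, mul_zero]
    rcases le_or_gt (q : ℝ) 0 with hq | hq
    · refine measure_mono_null (t := ∅) (fun x hx => ?_) measure_empty
      have : 0 ≤ ‖x‖ ^ d := by positivity
      exact absurd (hx.2.trans_le hq) (not_lt.2 this)
    · have hp : (q : ℝ) ≤ p := (le_max_iff.1 h).resolve_right (not_le.2 hq)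
      refine measure_mono_null (t := ∅) (fun x hx => ?_) measure_empty
      exact absurd (hx.1.trans hx.2) (not_lt.2 hp)
  · have e1 : Ioo (p : ℝ) q ∩ Ioi 0 = Ioo (max (p : ℝ) 0) q := by
      ext s
      simp only [mem_inter_iff, mem_Ioo, mem_Ioi, max_lt_iff]
      tauto
    rw [e1, Real.volume_Ioo, ← ENNReal.ofReal_mul hω.le, ← hIoo _ _ (le_max_right _ _) h.le]
    rcases le_or_gt 0 (p : ℝ) with hp | hp
    · rw [max_eq_left hp]
    · rw [max_eq_right hp.le]
      have : {x : EuclideanSpace ℝ (Fin d) | (p : ℝ) < ‖x‖ ^ d ∧ ‖x‖ ^ d < q} =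
          {x | ‖x‖ ^ d < (q : ℝ)} := by
        ext x
        have : 0 ≤ ‖x‖ ^ d := by positivity
        simp only [mem_ofPred_eq, and_iff_right_iff_imp]
        intro _; linarith
      rw [this, hIoo 0 q le_rfl ((le_max_right _ _).trans h.le), sub_zero,
        hlt q ((le_max_right _ _).trans h.le)]

theorem lintegral_norm_pow {d : ℕ} (hd : d ≠ 0) {f : ℝ → ℝ≥0∞} (hf : Measurable f) :
    ∫⁻ x : EuclideanSpace ℝ (Fin d), f (‖x‖ ^ d) =
      ENNReal.ofReal (unitBallVol d) * ∫⁻ s in Ioi (0 : ℝ), f s := by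
  have hm : Measurable fun x : EuclideanSpace ℝ (Fin d) => ‖x‖ ^ d := by fun_prop
  rw [← lintegral_map hf hm, map_norm_pow_volume hd, lintegral_smul_measure, smul_eq_mul]

theorem lintegral_fderiv_radial_le {d : ℕ} (hd : d ≠ 0) {h : ℝ → ℝ} (hh : Antitone h) :
    ∫⁻ x : EuclideanSpace ℝ (Fin d), ‖fderiv ℝ (fun x => h (‖x‖ ^ d)) x‖ₑ ^ 2 ≤
      ENNReal.ofReal (unitBallVol d) *
        ∫⁻ s in Ioi (0 : ℝ), ENNReal.ofReal (isoWeight d s * deriv h s ^ 2) := by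
  have hm : Measurable fun x : EuclideanSpace ℝ (Fin d) => ‖x‖ ^ d := by fun_prop
  have hmw : Measurable fun s => ENNReal.ofReal (isoWeight d s * deriv h s ^ 2) := by
    have : Measurable (isoWeight d) := by unfold isoWeight; fun_prop
    exact (this.mul ((measurable_deriv h).pow_const 2)).ennreal_ofReal
  rw [← lintegral_norm_pow hd hmw]
  refine lintegral_mono_ae ?_
  have hae : ∀ᵐ s ∂(Measure.map (fun x : EuclideanSpace ℝ (Fin d) => ‖x‖ ^ d) volume),
      0 < s ∧ DifferentiableAt ℝ h s := by
    rw [map_norm_pow_volume hd]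
    refine Measure.ae_smul_measure ?_ _
    filter_upwards [ae_restrict_mem measurableSet_Ioi,
      ae_restrict_of_ae hh.neg.ae_differentiableAt] with s h1 h2
    exact ⟨h1, by simpa using h2.neg⟩
  filter_upwards [ae_of_ae_map hm.aemeasurable hae] with x hx
  have hx0 : x ≠ 0 := by
    rintro rfl
    simp [hd] at hx
  have hn : HasFDerivAt (fun x : EuclideanSpace ℝ (Fin d) => ‖x‖)
      (fderiv ℝ (fun x : EuclideanSpace ℝ (Fin d) => ‖x‖) x) x :=
    (differentiableAt_id.norm ℝ hx0).hasFDerivAt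
  have hnl : ‖fderiv ℝ (fun x : EuclideanSpace ℝ (Fin d) => ‖x‖) x‖ ≤ 1 := by
    simpa using norm_fderiv_le_of_lipschitz ℝ (x₀ := x) lipschitzWith_one_norm
  have hF := hx.2.hasDerivAt.comp_hasFDerivAt x (hn.pow d)
  change HasFDerivAt (fun x => h (‖x‖ ^ d)) _ x at hF
  rw [hF.fderiv, ← ofReal_norm, ← ENNReal.ofReal_pow (norm_nonneg _)]
  apply ENNReal.ofReal_le_ofReal
  rw [isoWeight, Real.pow_rpow_inv_natCast (norm_nonneg x) hd, mul_comm, ← mul_pow]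
  rw [norm_smul, norm_smul, ← sq_abs (deriv h _ * _), abs_mul, ← Real.norm_eq_abs]
  gcongr
  rw [abs_of_nonneg (by positivity)]
  refine (mul_le_of_le_one_right (norm_nonneg _) hnl).trans (le_of_eq ?_)
  simp

section Dirichlet

variable {d : ℕ} {u : EuclideanSpace ℝ (Fin d) → ℝ} {K : NNReal} {R : ℝ}

theorem norm_gradient_eq (u : EuclideanSpace ℝ (Fin d) → ℝ) (x : EuclideanSpace ℝ (Fin d)) :
    ‖gradient u x‖ = ‖fderiv ℝ u x‖ := by
  rw [gradient, LinearIsometryEquiv.norm_map]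

theorem hasCompactSupport_of_norm_le (hR : ∀ x, R ≤ ‖x‖ → u x = 0) : HasCompactSupport u :=
  HasCompactSupport.intro (isCompact_closedBall 0 R) fun x hx =>
    hR x (le_of_lt (by simpa using hx))

theorem ofReal_integral_sq (hu : LipschitzWith K u) (hR : ∀ x, R ≤ ‖x‖ → u x = 0) :
    ENNReal.ofReal (∫ x, u x ^ 2) = ∫⁻ x, ENNReal.ofReal (u x ^ 2) := by
  refine ofReal_integral_eq_lintegral_ofReal ?_ (ae_of_all _ fun x => sq_nonneg _)
  refine Continuous.integrable_of_hasCompactSupport (hu.continuous.pow 2)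
    (hasCompactSupport_of_norm_le (R := R) fun x hx => ?_)
  simp [hR x hx]

theorem ofReal_integral_gradient_sq (hu : LipschitzWith K u) (hR : ∀ x, R ≤ ‖x‖ → u x = 0) :
    ENNReal.ofReal (∫ x, ‖gradient u x‖ ^ 2) = ∫⁻ x, ‖fderiv ℝ u x‖ₑ ^ 2 := by
  have he : ∀ x, ENNReal.ofReal (‖fderiv ℝ u x‖ ^ 2) = ‖fderiv ℝ u x‖ₑ ^ 2 := fun x => by
    rw [ENNReal.ofReal_pow (norm_nonneg _), ofReal_norm]
  simp only [norm_gradient_eq]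
  rw [integral_eq_lintegral_of_nonneg_ae (ae_of_all _ fun x => by positivity)
    ((measurable_fderiv ℝ u).norm.pow_const 2).aestronglyMeasurable]
  simp only [he]
  exact ENNReal.ofReal_toReal (lintegral_fderiv_sq_ne_top hu hR)

theorem rayleigh_nonneg (u : EuclideanSpace ℝ (Fin d) → ℝ) : 0 ≤ rayleigh d u :=
  div_nonneg (integral_nonneg fun x => by positivity) (integral_nonneg fun x => by positivity)

theorem dirichletEV_nonneg (Ω : Set (EuclideanSpace ℝ (Fin d))) : 0 ≤ dirichletEV d Ω :=
  Real.sInf_nonneg (by rintro _ ⟨u, _, rfl⟩; exact rayleigh_nonneg u)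

theorem dirichletEV_ball_mul_le {r : ℝ} (hr : 0 < r) (hu : LipschitzWith K u)
    (hR : ∀ x, r ≤ ‖x‖ → u x = 0) :
    ENNReal.ofReal (dirichletEV d (ball 0 1)) * ∫⁻ x, ENNReal.ofReal (u x ^ 2) ≤
      ENNReal.ofReal (r ^ 2) * ∫⁻ x, ‖fderiv ℝ u x‖ₑ ^ 2 := by
  rw [← ofReal_integral_sq hu hR, ← ofReal_integral_gradient_sq hu hR,
    ← ENNReal.ofReal_mul (dirichletEV_nonneg _), ← ENNReal.ofReal_mul (by positivity)]
  apply ENNReal.ofReal_le_ofReal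
  by_cases h0 : u =ᵐ[volume] fun _ => (0 : ℝ)
  · have : ∫ x, u x ^ 2 = 0 := by
      rw [integral_eq_zero_of_ae]
      filter_upwards [h0] with x hx
      simp [hx]
    rw [this, mul_zero]
    exact mul_nonneg (by positivity) (integral_nonneg fun x => by positivity)
  set F : EuclideanSpace ℝ (Fin d) → ℝ := fun x => u (r • x) with hF
  have hFL : LipschitzWith (K * ‖r‖₊) F := hu.comp (lipschitzWith_smul r)
  have hF0 : ¬ (F =ᵐ[volume] fun _ => (0 : ℝ)) := by
    intro h
    apply h0
    have hq : Measure.QuasiMeasurePreserving (fun x : EuclideanSpace ℝ (Fin d) => r⁻¹ • x) volume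
        volume := by
      refine ⟨by fun_prop, ?_⟩
      rw [Measure.map_addHaar_smul _ (inv_ne_zero hr.ne')]
      exact Measure.smul_absolutelyContinuous
    filter_upwards [hq.ae h] with x hx
    simpa [hF, smul_smul, hr.ne'] using hx
  have hT : IsDirTrial d (ball 0 1) F := by
    refine ⟨⟨_, hFL⟩, fun x hx => hR _ ?_, hF0⟩
    rw [mem_ball_zero_iff, not_lt] at hx
    rw [norm_smul, Real.norm_of_nonneg hr.le]
    exact le_mul_of_one_le_right hr.le hx
  have hle : dirichletEV d (ball 0 1) ≤ rayleigh d F :=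
    csInf_le ⟨0, by rintro _ ⟨u, _, rfl⟩; exact rayleigh_nonneg u⟩ ⟨F, hT, rfl⟩
  have e1 : ∫ x, F x ^ 2 = |(r ^ d)⁻¹| * ∫ x, u x ^ 2 := by
    have := Measure.integral_comp_smul (volume : Measure (EuclideanSpace ℝ (Fin d)))
      (fun x => u x ^ 2) r
    simpa [hF] using this
  have e2 : ∫ x, ‖gradient F x‖ ^ 2 = r ^ 2 * (|(r ^ d)⁻¹| * ∫ x, ‖gradient u x‖ ^ 2) := by
    have := Measure.integral_comp_smul (volume : Measure (EuclideanSpace ℝ (Fin d)))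
      (fun x => ‖gradient u x‖ ^ 2) r
    rw [finrank_euclideanSpace_fin, smul_eq_mul] at this
    rw [← this, ← integral_const_mul]
    congr 1
    ext x
    rw [norm_gradient_eq, norm_gradient_eq, hF, fderiv_comp_smul, norm_smul, mul_pow,
      Real.norm_eq_abs, sq_abs]
  have hc : 0 < |(r ^ d)⁻¹| := by positivity
  have hpos : 0 < ∫ x, u x ^ 2 := by
    refine lt_of_le_of_ne (integral_nonneg fun x => sq_nonneg _) fun h => h0 ?_
    have hi : Integrable fun x => u x ^ 2 :=
      Continuous.integrable_of_hasCompactSupport (hu.continuous.pow 2)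
        (hasCompactSupport_of_norm_le (R := r) fun x hx => by simp [hR x hx])
    have := (integral_eq_zero_iff_of_nonneg (fun x => sq_nonneg _) hi).1 h.symm
    filter_upwards [this] with x hx
    simpa using hx
  rw [rayleigh, e1, e2, le_div_iff₀ (by positivity)] at hle
  refine le_of_mul_le_mul_left ?_ hc
  linarith

end Dirichlet

theorem lintegral_Ioi_ofReal_of_antitone {f : ℝ → ℝ} (hf : Antitone f) (hf0 : ∀ s, 0 ≤ f s)
    {T : ℝ} (hT : 0 ≤ T) (hfT : ∀ s, T ≤ s → f s = 0) :
    ∫⁻ s in Ioi (0 : ℝ), ENNReal.ofReal (f s) = ENNReal.ofReal (∫ s in 0..T, f s) := by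
  have hi : IntervalIntegrable f volume 0 T := hf.intervalIntegrable
  rw [intervalIntegrable_iff_integrableOn_Ioc_of_le hT] at hi
  rw [intervalIntegral.integral_of_le hT, ofReal_integral_eq_lintegral_ofReal hi
    (ae_of_all _ hf0), ← Ioc_union_Ioi_eq_Ioi hT, lintegral_union measurableSet_Ioi
    (Ioc_disjoint_Ioi le_rfl), setLIntegral_congr_fun (g := fun _ => 0) measurableSet_Ioi]
  · simp
  · intro s hs
    simp [hfT s (le_of_lt hs)]

theorem isoWeight_le {d : ℕ} (hd : 2 ≤ d) {α b s t : ℝ} (hα : 0 < α)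
    (hb : b = α ^ ((d : ℝ) / ((d : ℝ) - 1))) (hs : 0 ≤ s) (ht : 0 ≤ t) (hst : s ≤ b * t) :
    isoWeight d s ≤ α ^ 2 * isoWeight d t := by
  have hb0 : 0 ≤ b := by rw [hb]; positivity
  have h1 : (b ^ (d : ℝ)⁻¹) ^ (d - 1) = α := by
    have hd' : (2 : ℝ) ≤ d := by exact_mod_cast hd
    rw [hb, ← Real.rpow_natCast, ← Real.rpow_mul hα.le, ← Real.rpow_mul hα.le,
      Nat.cast_sub (by omega)]
    have : (d : ℝ) / (d - 1) * (d : ℝ)⁻¹ * ((d : ℝ) - (1 : ℕ)) = 1 := by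
      have : (d : ℝ) - 1 ≠ 0 := by linarith
      push_cast
      field_simp
    rw [this, Real.rpow_one]
  rw [isoWeight, isoWeight, ← mul_pow]
  have h2 : s ^ (d : ℝ)⁻¹ ≤ b ^ (d : ℝ)⁻¹ * t ^ (d : ℝ)⁻¹ := by
    rw [← Real.mul_rpow hb0 ht]
    exact Real.rpow_le_rpow hs hst (by positivity)
  refine pow_le_pow_left₀ (by positivity) ?_ 2
  calc (d : ℝ) * (s ^ (d : ℝ)⁻¹) ^ (d - 1)
      ≤ d * (b ^ (d : ℝ)⁻¹ * t ^ (d : ℝ)⁻¹) ^ (d - 1) := by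
        gcongr
    _ = _ := by rw [mul_pow, h1]; ring

theorem lipschitz_profile_sub_norm_pow {d : ℕ} (hd : d ≠ 0) {u : EuclideanSpace ℝ (Fin d) → ℝ}
    {K : NNReal} {R : ℝ} (hu : LipschitzWith K u) (hR : ∀ x, R ≤ ‖x‖ → u x = 0) {r r' : ℝ}
    (hr : 0 ≤ r) (hr' : 0 ≤ r') :
    |profile u (r ^ d) - profile u (r' ^ d)| ≤ K * |r - r'| := by
  wlog h : r ≤ r' generalizing r r'
  · rw [abs_sub_comm, abs_sub_comm r]
    exact this hr' hr (le_of_not_ge h)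
  rcases h.eq_or_lt with rfl | h
  · simp
  · rw [abs_of_nonneg (sub_nonneg.2 (profile_antitone hu hR (pow_le_pow_left₀ hr h.le d))),
      abs_sub_comm, abs_of_pos (sub_pos.2 h)]
    exact profile_pow_sub_le hd hu hR hr h

theorem abs_profile_sub_le {d : ℕ} (hd : d ≠ 0) {u : EuclideanSpace ℝ (Fin d) → ℝ}
    {K : NNReal} {R : ℝ} (hu : LipschitzWith K u) (hR : ∀ x, R ≤ ‖x‖ → u x = 0) {r s t : ℝ}
    (hr : 0 < r) (hs : r ^ d ≤ s) (ht : r ^ d ≤ t) :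
    |profile u s - profile u t| ≤ K * (r ^ (d - 1))⁻¹ * |s - t| := by
  wlog h : t ≤ s generalizing s t
  · rw [abs_sub_comm, abs_sub_comm s]
    exact this ht hs (le_of_not_ge h)
  have hs0 : 0 ≤ s := (pow_pos hr d).le.trans hs
  have ht0 : 0 ≤ t := (pow_pos hr d).le.trans ht
  set a := s ^ (d : ℝ)⁻¹ with ha
  set b := t ^ (d : ℝ)⁻¹ with hb
  have hsa : a ^ d = s := Real.rpow_inv_natCast_pow hs0 hd
  have htb : b ^ d = t := Real.rpow_inv_natCast_pow ht0 hd
  have ha0 : 0 ≤ a := by positivity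
  have hb0 : 0 ≤ b := by positivity
  have hba : b ≤ a := Real.rpow_le_rpow ht0 h (by positivity)
  have hra : r ≤ a := le_of_pow_le_pow_left₀ hd ha0 (by rw [hsa]; exact hs)
  have h1 := lipschitz_profile_sub_norm_pow hd hu hR ha0 hb0
  rw [hsa, htb] at h1
  refine h1.trans ?_
  rw [mul_assoc]
  refine mul_le_mul_of_nonneg_left ?_ K.coe_nonneg
  rw [inv_mul_eq_div, le_div_iff₀ (by positivity), abs_of_nonneg (sub_nonneg.2 hba),
    abs_of_nonneg (sub_nonneg.2 h), ← hsa, ← htb]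
  obtain ⟨n, rfl⟩ := Nat.exists_eq_succ_of_ne_zero hd
  simp only [Nat.succ_eq_add_one, Nat.add_sub_cancel, pow_succ]
  have e1 : (a - b) * r ^ n ≤ (a - b) * a ^ n :=
    mul_le_mul_of_nonneg_left (pow_le_pow_left₀ hr.le hra n) (sub_nonneg.2 hba)
  have e2 : b * b ^ n ≤ b * a ^ n :=
    mul_le_mul_of_nonneg_left (pow_le_pow_left₀ hb0 hba n) hb0
  linarith

/-- The reflected tail of `P`, rescaled by `α`. -/
def reflectedTail (P : ℝ → ℝ) (α s₀ T s : ℝ) : ℝ := (P s₀ - P (max s₀ (T - s))) / α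

theorem reflectedTail_antitone {P : ℝ → ℝ} (hP : Antitone P) {α : ℝ} (hα : 0 < α) (s₀ T : ℝ) :
    Antitone (reflectedTail P α s₀ T) := by
  intro s s' h
  unfold reflectedTail
  gcongr
  exact hP (max_le_max_left _ (by linarith))

theorem reflectedTail_nonneg {P : ℝ → ℝ} (hP : Antitone P) {α : ℝ} (hα : 0 < α) (s₀ T s : ℝ) :
    0 ≤ reflectedTail P α s₀ T s :=
  div_nonneg (sub_nonneg.2 (hP (le_max_left _ _))) hα.le

theorem reflectedTail_eq_zero {P : ℝ → ℝ} {α s₀ T s : ℝ} (h : T - s₀ ≤ s) :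
    reflectedTail P α s₀ T s = 0 := by
  rw [reflectedTail, max_eq_left (by linarith), sub_self, zero_div]

/-- Truncation of `P` above level `P s₀`. -/
def truncatedTop (P : ℝ → ℝ) (s₀ s : ℝ) : ℝ := max (P s - P s₀) 0

theorem truncatedTop_antitone {P : ℝ → ℝ} (hP : Antitone P) (s₀ : ℝ) :
    Antitone (truncatedTop P s₀) := fun _ _ h => max_le_max_right _ (sub_le_sub_right (hP h) _)

theorem truncatedTop_eq_zero {P : ℝ → ℝ} (hP : Antitone P) {s₀ s : ℝ} (h : s₀ ≤ s) :
    truncatedTop P s₀ s = 0 := max_eq_right (sub_nonpos.2 (hP h))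

theorem truncatedTop_of_le {P : ℝ → ℝ} (hP : Antitone P) {s₀ s : ℝ} (h : s ≤ s₀) :
    truncatedTop P s₀ s = P s - P s₀ := max_eq_left (sub_nonneg.2 (hP h))

theorem Antitone.sq_of_nonneg {f : ℝ → ℝ} (hf : Antitone f) (hf0 : ∀ s, 0 ≤ f s) :
    Antitone fun s => f s ^ 2 := fun _ _ h => pow_le_pow_left₀ (hf0 _) (hf h) 2

theorem rearranged_mass_le {P Q : ℝ → ℝ} (hP : Antitone P) (hQ : Antitone Q)
    (hP0 : ∀ s, 0 ≤ P s) (hQ0 : ∀ s, 0 ≤ Q s) {α s₀ T sP sQ : ℝ} (hα : 0 < α) (hα1 : α ≤ 1)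
    (hT : 0 ≤ T) (hPz : ∀ s, sP ≤ s → P s = 0) (hQz : ∀ s, sQ ≤ s → Q s = 0)
    (hsum : sP + sQ ≤ T) (hPQ : α * ∫ s in 0..T, P s ≤ ∫ s in 0..T, Q s) :
    (∫ s in 0..T, P s ^ 2) + ∫ s in 0..T, Q s ^ 2 ≤
      (∫ s in 0..T, truncatedTop P s₀ s ^ 2) +
        ∫ s in 0..T, (Q s + reflectedTail P α s₀ T s) ^ 2 := by
  have iA : ∀ f : ℝ → ℝ, Antitone f → IntervalIntegrable f volume 0 T := fun f hf =>
    hf.intervalIntegrable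
  set c := P s₀ with hc
  set k := reflectedTail P α s₀ T with hk
  have hkA := reflectedTail_antitone hP hα s₀ T
  have hk0 := reflectedTail_nonneg hP hα s₀ T
  have hMA : Monotone fun s => c - P (max s₀ s) := fun s s' h =>
    sub_le_sub_left (hP (max_le_max_left _ h)) _
  have hMsq : Monotone fun s => (c - P (max s₀ s)) ^ 2 := fun s s' h =>
    pow_le_pow_left₀ (sub_nonneg.2 (hP (le_max_left _ _))) (hMA h) 2
  have iP := iA P hP
  have iQ := iA Q hQ
  have iP2 := iA _ (hP.sq_of_nonneg hP0)
  have iQ2 := iA _ (hQ.sq_of_nonneg hQ0)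
  have ik2 := iA _ (hkA.sq_of_nonneg hk0)
  have it2 := iA _ ((truncatedTop_antitone hP s₀).sq_of_nonneg fun s => le_max_right _ _)
  have iM2 : IntervalIntegrable (fun s => (c - P (max s₀ s)) ^ 2) volume 0 T :=
    hMsq.intervalIntegrable
  have hcross : ∀ s, Q s * k s = c / α * Q s := by
    intro s
    rcases le_or_gt sQ s with h | h
    · rw [hQz s h]; ring
    · have : k s = c / α := by
        rw [hk, reflectedTail, hPz (max s₀ (T - s)), sub_zero]
        exact le_max_of_le_right (by linarith)
      rw [this]; ring
  have e1 : ∫ s in 0..T, (Q s + k s) ^ 2 = (∫ s in 0..T, Q s ^ 2) +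
      2 * (c / α) * (∫ s in 0..T, Q s) + ∫ s in 0..T, k s ^ 2 := by
    rw [← intervalIntegral.integral_const_mul, ← intervalIntegral.integral_add iQ2
      (iQ.const_mul _), ← intervalIntegral.integral_add (iQ2.add (iQ.const_mul _)) ik2]
    refine intervalIntegral.integral_congr fun s _ => ?_
    have := hcross s
    linear_combination 2 * this
  have e2 : ∫ s in 0..T, (c - P (max s₀ s)) ^ 2 ≤ ∫ s in 0..T, k s ^ 2 := by
    have h1 : ∫ s in 0..T, k s ^ 2 = (α ^ 2)⁻¹ * ∫ s in 0..T, (c - P (max s₀ s)) ^ 2 := by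
      have := intervalIntegral.integral_comp_sub_left (a := 0) (b := T)
        (fun s => (c - P (max s₀ s)) ^ 2) T
      rw [sub_self, sub_zero] at this
      rw [← this, ← intervalIntegral.integral_const_mul]
      refine intervalIntegral.integral_congr fun s _ => ?_
      simp only [hk, reflectedTail, ← hc]
      field_simp
    rw [h1]
    refine le_mul_of_one_le_left ?_ ?_
    · exact intervalIntegral.integral_nonneg hT fun s _ => sq_nonneg _
    · exact (one_le_inv₀ (by positivity)).2 (pow_le_one₀ hα.le hα1)
  have e3 : (∫ s in 0..T, truncatedTop P s₀ s ^ 2) + ∫ s in 0..T, (c - P (max s₀ s)) ^ 2 =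
      (∫ s in 0..T, P s ^ 2) - 2 * c * (∫ s in 0..T, P s) + c ^ 2 * T := by
    have : c ^ 2 * T = ∫ s in 0..T, c ^ 2 := by simp [mul_comm]
    rw [this, ← intervalIntegral.integral_const_mul, ← intervalIntegral.integral_sub iP2
      (iP.const_mul _), ← intervalIntegral.integral_add (iP2.sub (iP.const_mul _)) (by simp),
      ← intervalIntegral.integral_add it2 iM2]
    refine intervalIntegral.integral_congr fun s _ => ?_
    rcases le_total s s₀ with h | h
    · rw [truncatedTop_of_le hP h, max_eq_left h]; simp only [← hc]; ring
    · rw [truncatedTop_eq_zero hP h, max_eq_right h]; ring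
  have e4 : c * (∫ s in 0..T, P s) ≤ c / α * ∫ s in 0..T, Q s := by
    calc c * (∫ s in 0..T, P s) = c / α * (α * ∫ s in 0..T, P s) := by field_simp
      _ ≤ _ := mul_le_mul_of_nonneg_left hPQ (div_nonneg (hP0 _) hα.le)
  have e5 : 0 ≤ c ^ 2 * T := by positivity
  rw [e1]
  linarith

theorem rearranged_energy_le {d : ℕ} (hd : 2 ≤ d) {P Q : ℝ → ℝ} (hP : Antitone P)
    {α b s₀ T sP sQ : ℝ} (hα : 0 < α)
    (hb : b = α ^ ((d : ℝ) / ((d : ℝ) - 1))) (hs₀ : 0 < s₀) (hTb : T = (1 + b) * s₀)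
    (hPz : ∀ s, sP ≤ s → P s = 0) (hQz : ∀ s, sQ ≤ s → Q s = 0)
    (hsum : sP + sQ ≤ T) (hsQ : sQ ≤ s₀) :
    (∫⁻ s in Ioi 0, ENNReal.ofReal (isoWeight d s * deriv (truncatedTop P s₀) s ^ 2)) +
      (∫⁻ s in Ioi 0, ENNReal.ofReal
        (isoWeight d s * deriv (fun s => Q s + reflectedTail P α s₀ T s) s ^ 2)) ≤
    (∫⁻ s in Ioo 0 T, ENNReal.ofReal (isoWeight d s * deriv P s ^ 2)) +
      ∫⁻ s in Ioo 0 T, ENNReal.ofReal (isoWeight d s * deriv Q s ^ 2) := by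
  have hb0 : 0 < b := by rw [hb]; positivity
  have hmw : Measurable (isoWeight d) := by unfold isoWeight; fun_prop
  set p : ℝ → ℝ≥0∞ := fun s => ENNReal.ofReal (isoWeight d s * deriv P s ^ 2) with hp
  set q : ℝ → ℝ≥0∞ := fun s => ENNReal.ofReal (isoWeight d s * deriv Q s ^ 2) with hq
  have hpm : Measurable p := (hmw.mul ((measurable_deriv P).pow_const 2)).ennreal_ofReal
  have hqm : Measurable q := (hmw.mul ((measurable_deriv Q).pow_const 2)).ennreal_ofReal
  have hsT : s₀ < T := by rw [hTb]; nlinarith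
  have hTs : T - s₀ = b * s₀ := by rw [hTb]; ring
  have ae_ne : ∀ c : ℝ, ∀ᵐ s : ℝ, s ≠ c := fun c => by simp [ae_iff]
  have h1 : ∫⁻ s in Ioi 0, ENNReal.ofReal (isoWeight d s * deriv (truncatedTop P s₀) s ^ 2) ≤
      ∫⁻ s in Ioo 0 s₀, p s := by
    rw [← lintegral_indicator measurableSet_Ioo, ← lintegral_indicator measurableSet_Ioi]
    refine lintegral_mono_ae ?_
    filter_upwards [ae_ne s₀] with s hs
    by_cases hs0 : s ∈ Ioi (0 : ℝ)
    swap; · rw [indicator_of_notMem hs0]; exact zero_le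
    rw [indicator_of_mem hs0]
    rcases lt_or_gt_of_ne hs with h | h
    · rw [indicator_of_mem (show s ∈ Ioo 0 s₀ from ⟨hs0, h⟩)]
      have : truncatedTop P s₀ =ᶠ[nhds s] fun s => P s - P s₀ := by
        filter_upwards [Iio_mem_nhds h] with t ht using truncatedTop_of_le hP (le_of_lt ht)
      rw [this.deriv_eq, deriv_sub_const]
    · have : truncatedTop P s₀ =ᶠ[nhds s] fun s => 0 := by
        filter_upwards [Ioi_mem_nhds h] with t ht using truncatedTop_eq_zero hP (le_of_lt ht)
      rw [this.deriv_eq]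
      simp
  have h2 : ∫⁻ s in Ioi 0, ENNReal.ofReal
      (isoWeight d s * deriv (fun s => Q s + reflectedTail P α s₀ T s) s ^ 2) ≤
      (∫⁻ s in Ioo 0 T, q s) + ∫⁻ s in Ioo 0 (T - s₀), p (T - s) := by
    rw [← lintegral_indicator measurableSet_Ioo, ← lintegral_indicator measurableSet_Ioi,
      ← lintegral_indicator measurableSet_Ioo, ← lintegral_add_left
        (hqm.indicator measurableSet_Ioo)]
    refine lintegral_mono_ae ?_
    filter_upwards [ae_ne sQ, ae_ne (T - s₀)] with s hs hs'
    by_cases hs0 : s ∈ Ioi (0 : ℝ)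
    swap; · rw [indicator_of_notMem hs0]; exact zero_le
    rw [indicator_of_mem hs0]
    rcases lt_or_gt_of_ne hs with h | h
    · rw [indicator_of_mem (show s ∈ Ioo 0 T from ⟨hs0, by linarith⟩)]
      refine le_add_right (le_of_eq ?_)
      have : (fun s => Q s + reflectedTail P α s₀ T s) =ᶠ[nhds s] fun s => Q s + P s₀ / α := by
        filter_upwards [Iio_mem_nhds h] with t ht
        have ht' : t < sQ := ht
        rw [reflectedTail, hPz (max s₀ (T - t)) (le_max_of_le_right (by linarith)), sub_zero]
      rw [this.deriv_eq, deriv_add_const]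
    · have hQ : ∀ᶠ t in nhds s, Q t = 0 := by
        filter_upwards [Ioi_mem_nhds h] with t ht using hQz t (le_of_lt ht)
      rcases lt_or_gt_of_ne hs' with h' | h'
      · refine le_add_left ?_
        rw [indicator_of_mem (show s ∈ Ioo 0 (T - s₀) from ⟨hs0, h'⟩)]
        have : (fun s => Q s + reflectedTail P α s₀ T s) =ᶠ[nhds s]
            fun s => (P s₀ - P (T - s)) / α := by
          filter_upwards [hQ, Iio_mem_nhds h'] with t ht ht'
          have ht'' : t < T - s₀ := ht'
          rw [ht, zero_add, reflectedTail, max_eq_right (by linarith)]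
        rw [this.deriv_eq, deriv_div_const, deriv_const_sub, deriv_comp_const_sub, neg_neg]
        apply ENNReal.ofReal_le_ofReal
        have hw : isoWeight d s ≤ α ^ 2 * isoWeight d (T - s) := by
          have hs0' : 0 < s := hs0
          refine isoWeight_le hd hα hb hs0'.le (by linarith) ?_
          nlinarith
        rw [div_pow, mul_div_assoc', div_le_iff₀ (by positivity)]
        calc _ ≤ α ^ 2 * isoWeight d (T - s) * deriv P (T - s) ^ 2 := by gcongr
          _ = _ := by ring
      · have : (fun s => Q s + reflectedTail P α s₀ T s) =ᶠ[nhds s] fun s => 0 := by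
          filter_upwards [hQ, Ioi_mem_nhds h'] with t ht ht'
          rw [ht, zero_add, reflectedTail_eq_zero (le_of_lt ht')]
        rw [this.deriv_eq]
        simp
  have h3 : ∫⁻ s in Ioo 0 (T - s₀), p (T - s) = ∫⁻ s in Ioo s₀ T, p s := by
    rw [← lintegral_indicator measurableSet_Ioo, ← lintegral_indicator measurableSet_Ioo,
      ← lintegral_sub_left_eq_self _ T]
    refine lintegral_congr fun s => ?_
    by_cases h : s ∈ Ioo s₀ T
    · rw [indicator_of_mem (show T - s ∈ Ioo 0 (T - s₀) from ⟨by linarith [h.2],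
        by linarith [h.1]⟩), indicator_of_mem h, sub_sub_cancel]
    · rw [indicator_of_notMem h, indicator_of_notMem]
      rintro ⟨h1, h2⟩
      exact h ⟨by linarith, by linarith⟩
  have h4 : (∫⁻ s in Ioo 0 s₀, p s) + ∫⁻ s in Ioo s₀ T, p s ≤ ∫⁻ s in Ioo 0 T, p s := by
    rw [← lintegral_union measurableSet_Ioo (disjoint_left.2 fun x hx hx' =>
      lt_asymm hx.2 hx'.1)]
    exact lintegral_mono_set (union_subset (Ioo_subset_Ioo_right hsT.le)
      (Ioo_subset_Ioo_left hs₀.le))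
  calc _ ≤ (∫⁻ s in Ioo 0 s₀, p s) + ((∫⁻ s in Ioo 0 T, q s) + ∫⁻ s in Ioo s₀ T, p s) := by
        rw [← h3]; exact add_le_add h1 h2
    _ = ((∫⁻ s in Ioo 0 s₀, p s) + ∫⁻ s in Ioo s₀ T, p s) + ∫⁻ s in Ioo 0 T, q s := by
        ring
    _ ≤ _ := by gcongr

theorem lipschitz_profile_norm_pow {d : ℕ} (hd : d ≠ 0) {u : EuclideanSpace ℝ (Fin d) → ℝ}
    {K : NNReal} {R : ℝ} (hu : LipschitzWith K u) (hR : ∀ x, R ≤ ‖x‖ → u x = 0) :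
    LipschitzWith K fun x : EuclideanSpace ℝ (Fin d) => profile u (‖x‖ ^ d) := by
  refine LipschitzWith.of_dist_le_mul fun x y => ?_
  rw [Real.dist_eq]
  refine (lipschitz_profile_sub_norm_pow hd hu hR (norm_nonneg _) (norm_nonneg _)).trans ?_
  rw [dist_eq_norm]
  exact mul_le_mul_of_nonneg_left (abs_norm_sub_norm_le x y) K.coe_nonneg

theorem lipschitz_truncatedTop_norm_pow {d : ℕ} (hd : d ≠ 0)
    {u : EuclideanSpace ℝ (Fin d) → ℝ}
    {K : NNReal} {R : ℝ} (hu : LipschitzWith K u) (hR : ∀ x, R ≤ ‖x‖ → u x = 0) (s₀ : ℝ) :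
    LipschitzWith K fun x : EuclideanSpace ℝ (Fin d) =>
      truncatedTop (profile u) s₀ (‖x‖ ^ d) := by
  have h1 : LipschitzWith K fun x : EuclideanSpace ℝ (Fin d) =>
      profile u (‖x‖ ^ d) - profile u s₀ := by
    refine LipschitzWith.of_dist_le_mul fun x y => ?_
    rw [dist_sub_right]
    exact (lipschitz_profile_norm_pow hd hu hR).dist_le_mul x y
  exact h1.max_const 0

theorem lipschitz_reflectedTail_norm_pow {d : ℕ} (hd : d ≠ 0)
    {u : EuclideanSpace ℝ (Fin d) → ℝ}
    {K : NNReal} {R : ℝ} (hu : LipschitzWith K u) (hR : ∀ x, R ≤ ‖x‖ → u x = 0)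
    {α s₀ T : ℝ} (hα : 0 < α) (hs₀ : 0 < s₀) (hT : 0 ≤ T) :
    ∃ K', LipschitzWith K' fun x : EuclideanSpace ℝ (Fin d) =>
      reflectedTail (profile u) α s₀ T (‖x‖ ^ d) := by
  set r := s₀ ^ (d : ℝ)⁻¹ with hr
  set M := T ^ (d : ℝ)⁻¹ with hM
  have hr0 : 0 < r := by positivity
  have hM0 : 0 ≤ M := by positivity
  have hrd : r ^ d = s₀ := Real.rpow_inv_natCast_pow hs₀.le hd
  have hMd : M ^ d = T := Real.rpow_inv_natCast_pow hT hd
  set L : ℝ := K * (r ^ (d - 1))⁻¹ with hL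
  have hL0 : 0 ≤ L := by positivity
  have hC0 : 0 ≤ α⁻¹ * (L * (d * M ^ (d - 1))) := by positivity
  refine ⟨Real.toNNReal (α⁻¹ * (L * (d * M ^ (d - 1)))), LipschitzWith.of_dist_le_mul fun x y => ?_⟩
  rw [Real.dist_eq, Real.coe_toNNReal _ hC0]
  have hclamp : ∀ z : EuclideanSpace ℝ (Fin d),
      max s₀ (T - ‖z‖ ^ d) = max s₀ (T - min ‖z‖ M ^ d) := by
    intro z
    rcases le_total ‖z‖ M with h | h
    · rw [min_eq_left h]
    · rw [min_eq_right h, hMd, sub_self, max_eq_left hs₀.le, max_eq_left]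
      have : T ≤ ‖z‖ ^ d := hMd ▸ pow_le_pow_left₀ hM0 h d
      linarith
  have hmin : ∀ z : EuclideanSpace ℝ (Fin d), 0 ≤ min ‖z‖ M := fun z =>
    le_min (norm_nonneg _) hM0
  calc |reflectedTail (profile u) α s₀ T (‖x‖ ^ d) - reflectedTail (profile u) α s₀ T (‖y‖ ^ d)|
      = α⁻¹ * |profile u (max s₀ (T - min ‖x‖ M ^ d)) -
          profile u (max s₀ (T - min ‖y‖ M ^ d))| := by
        rw [reflectedTail, reflectedTail, hclamp, hclamp, ← sub_div, abs_div, abs_of_pos hα,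
          sub_sub_sub_cancel_left, abs_sub_comm, div_eq_inv_mul]
    _ ≤ α⁻¹ * (L * |max s₀ (T - min ‖x‖ M ^ d) - max s₀ (T - min ‖y‖ M ^ d)|) := by
        gcongr
        exact abs_profile_sub_le hd hu hR hr0 (hrd.le.trans (le_max_left _ _))
          (hrd.le.trans (le_max_left _ _))
    _ ≤ α⁻¹ * (L * |min ‖x‖ M ^ d - min ‖y‖ M ^ d|) := by
        have h1 : |max s₀ (T - min ‖x‖ M ^ d) - max s₀ (T - min ‖y‖ M ^ d)| ≤
            |min ‖x‖ M ^ d - min ‖y‖ M ^ d| := by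
          refine (abs_max_sub_max_le_max s₀ (T - min ‖x‖ M ^ d) s₀ (T - min ‖y‖ M ^ d)).trans ?_
          rw [sub_self, abs_zero, max_eq_right (abs_nonneg _), sub_sub_sub_cancel_left,
            abs_sub_comm]
        gcongr
    _ ≤ α⁻¹ * (L * (d * M ^ (d - 1) * ‖x - y‖)) := by
        gcongr
        refine (abs_pow_sub_pow_le (min ‖x‖ M) (min ‖y‖ M) d).trans ?_
        rw [abs_of_nonneg (hmin x), abs_of_nonneg (hmin y)]
        have h1 : |min ‖x‖ M - min ‖y‖ M| ≤ ‖x - y‖ := by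
          refine (abs_min_sub_min_le_max _ _ _ _).trans ?_
          rw [sub_self, abs_zero, max_eq_left (abs_nonneg _)]
          exact abs_norm_sub_norm_le x y
        have h2 : max (min ‖x‖ M) (min ‖y‖ M) ^ (d - 1) ≤ M ^ (d - 1) :=
          pow_le_pow_left₀ (le_max_of_le_left (hmin x))
            (max_le (min_le_right _ _) (min_le_right _ _)) _
        calc _ ≤ ‖x - y‖ * d * M ^ (d - 1) := by gcongr
          _ = _ := by ring
    _ = _ := by rw [dist_eq_norm]; ring

/-- The central inequality: two nonnegative functions with disjoint-type volume constraints. -/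
theorem dirichletEV_mul_le_of_unbalanced {d : ℕ} (hd : 2 ≤ d)
    {v w : EuclideanSpace ℝ (Fin d) → ℝ} {K K' : NNReal} {R : ℝ}
    (hv : LipschitzWith K v) (hvR : ∀ x, R ≤ ‖x‖ → v x = 0) (hv0 : ∀ x, 0 ≤ v x)
    (hw : LipschitzWith K' w) (hwR : ∀ x, R ≤ ‖x‖ → w x = 0) (hw0 : ∀ x, 0 ≤ w x)
    {α b s₀ : ℝ} (hα : 0 < α) (hα1 : α ≤ 1) (hb : b = α ^ ((d : ℝ) / ((d : ℝ) - 1)))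
    (hs₀ : 0 < s₀)
    (hvol : volume.real {x | 0 < v x} + volume.real {x | 0 < w x} ≤
      unitBallVol d * ((1 + b) * s₀))
    (hwvol : volume.real {x | 0 < w x} ≤ unitBallVol d * s₀)
    (hvw : ENNReal.ofReal α * ∫⁻ x, ENNReal.ofReal (v x) ≤ ∫⁻ x, ENNReal.ofReal (w x)) :
    ENNReal.ofReal (dirichletEV d (ball 0 1)) *
      ((∫⁻ x, ENNReal.ofReal (v x ^ 2)) + ∫⁻ x, ENNReal.ofReal (w x ^ 2)) ≤
    ENNReal.ofReal ((s₀ ^ (d : ℝ)⁻¹) ^ 2) *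
      ((∫⁻ x, ‖fderiv ℝ v x‖ₑ ^ 2) + ∫⁻ x, ‖fderiv ℝ w x‖ₑ ^ 2) := by
  have hd0 : d ≠ 0 := by omega
  have hd1 : (2 : ℝ) ≤ d := by exact_mod_cast hd
  have hω := unitBallVol_pos d
  have hω0 : ENNReal.ofReal (unitBallVol d) ≠ 0 := (ENNReal.ofReal_pos.2 hω).ne'
  have hb0 : 0 < b := by rw [hb]; positivity
  have hb1 : b ≤ 1 := by
    rw [hb]
    exact Real.rpow_le_one hα.le hα1 (div_nonneg (by linarith) (by linarith))
  set T := (1 + b) * s₀ with hT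
  have hT0 : 0 ≤ T := by positivity
  have hs₀T : s₀ ≤ T := by rw [hT]; nlinarith
  set sv := volume.real {x | 0 < v x} / unitBallVol d with hsv
  set sw := volume.real {x | 0 < w x} / unitBallVol d with hsw
  have hsum : sv + sw ≤ T := by
    rw [hsv, hsw, ← add_div, div_le_iff₀ hω]; linarith
  have hsw0 : sw ≤ s₀ := by rw [hsw, div_le_iff₀ hω]; linarith
  have hsvn : 0 ≤ sv := by positivity
  have hswn : 0 ≤ sw := by positivity
  set P := profile v with hP
  set Q := profile w with hQ
  have hPA : Antitone P := profile_antitone hv hvR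
  have hQA : Antitone Q := profile_antitone hw hwR
  have hP0 : ∀ s, 0 ≤ P s := profile_nonneg hv hvR
  have hQ0 : ∀ s, 0 ≤ Q s := profile_nonneg hw hwR
  have hPz : ∀ s, sv ≤ s → P s = 0 := fun s hs =>
    profile_eq_zero hv hvR (hsvn.trans hs) (by rw [hsv, div_le_iff₀ hω] at hs; linarith)
  have hQz : ∀ s, sw ≤ s → Q s = 0 := fun s hs =>
    profile_eq_zero hw hwR (hswn.trans hs) (by rw [hsw, div_le_iff₀ hω] at hs; linarith)
  have hPT : ∀ s, T ≤ s → P s = 0 := fun s hs => hPz s (by linarith)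
  have hQT : ∀ s, T ≤ s → Q s = 0 := fun s hs => hQz s (by linarith)
  set U := truncatedTop P s₀ with hU
  set W : ℝ → ℝ := fun s => Q s + reflectedTail P α s₀ T s with hW
  have hUA : Antitone U := truncatedTop_antitone hPA s₀
  have hWA : Antitone W := hQA.add (reflectedTail_antitone hPA hα s₀ T)
  have hU0 : ∀ s, 0 ≤ U s := fun s => le_max_right _ _
  have hW0 : ∀ s, 0 ≤ W s := fun s => add_nonneg (hQ0 s) (reflectedTail_nonneg hPA hα _ _ s)
  have hUz : ∀ s, s₀ ≤ s → U s = 0 := fun s hs => truncatedTop_eq_zero hPA hs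
  have hWz : ∀ s, s₀ ≤ s → W s = 0 := fun s hs => by
    rw [hW]
    dsimp only
    rw [hQz s (hsw0.trans hs), reflectedTail_eq_zero (by rw [hT]; nlinarith), add_zero]
  have hPQ : α * ∫ s in 0..T, P s ≤ ∫ s in 0..T, Q s := by
    have e1 := lintegral_profile_rpow hv hvR hv0 one_pos
    have e2 := lintegral_profile_rpow hw hwR hw0 one_pos
    simp only [Real.rpow_one] at e1 e2
    rw [← e1, ← e2, mul_left_comm, ENNReal.mul_le_mul_iff_right hω0 ENNReal.ofReal_ne_top,
      lintegral_Ioi_ofReal_of_antitone hPA hP0 hT0 hPT,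
      lintegral_Ioi_ofReal_of_antitone hQA hQ0 hT0 hQT, ← ENNReal.ofReal_mul hα.le] at hvw
    exact (ENNReal.ofReal_le_ofReal_iff
      (intervalIntegral.integral_nonneg hT0 fun s _ => hQ0 s)).1 hvw
  have hmass := rearranged_mass_le (s₀ := s₀) hPA hQA hP0 hQ0 hα hα1 hT0 hPz hQz hsum hPQ
  have henergy := rearranged_energy_le hd hPA hα hb hs₀ hT hPz hQz hsum hsw0
  have conv : ∀ f : ℝ → ℝ, Antitone f → (∀ s, 0 ≤ f s) → (∀ s, T ≤ s → f s = 0) →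
      ∫⁻ s in Ioi 0, ENNReal.ofReal (f s ^ 2) = ENNReal.ofReal (∫ s in 0..T, f s ^ 2) :=
    fun f h1 h2 h3 => lintegral_Ioi_ofReal_of_antitone (h1.sq_of_nonneg h2)
      (fun s => sq_nonneg _) hT0 fun s hs => by simp [h3 s hs]
  have hmass' : (∫⁻ s in Ioi 0, ENNReal.ofReal (P s ^ 2)) +
      (∫⁻ s in Ioi 0, ENNReal.ofReal (Q s ^ 2)) ≤
      (∫⁻ s in Ioi 0, ENNReal.ofReal (U s ^ 2)) + ∫⁻ s in Ioi 0, ENNReal.ofReal (W s ^ 2) := by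
    have nn : ∀ f : ℝ → ℝ, 0 ≤ ∫ s in 0..T, f s ^ 2 := fun f =>
      intervalIntegral.integral_nonneg hT0 fun s _ => sq_nonneg _
    rw [conv P hPA hP0 hPT, conv Q hQA hQ0 hQT, conv U hUA hU0 fun s hs => hUz s (hs₀T.trans hs),
      conv W hWA hW0 fun s hs => hWz s (hs₀T.trans hs), ← ENNReal.ofReal_add (nn _) (nn _),
      ← ENNReal.ofReal_add (nn _) (nn _)]
    exact ENNReal.ofReal_le_ofReal hmass
  set r := s₀ ^ (d : ℝ)⁻¹ with hr
  have hr0 : 0 < r := by positivity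
  have hrd : r ^ d = s₀ := Real.rpow_inv_natCast_pow hs₀.le hd0
  have hrle : ∀ x : EuclideanSpace ℝ (Fin d), r ≤ ‖x‖ → s₀ ≤ ‖x‖ ^ d := fun x hx =>
    hrd ▸ pow_le_pow_left₀ hr0.le hx d
  have hUL := lipschitz_truncatedTop_norm_pow hd0 hv hvR s₀
  obtain ⟨K₂, hK₂⟩ := lipschitz_reflectedTail_norm_pow hd0 hv hvR (T := T) hα hs₀ hT0
  have hWL : LipschitzWith (K' + K₂) fun x : EuclideanSpace ℝ (Fin d) => W (‖x‖ ^ d) :=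
    (lipschitz_profile_norm_pow hd0 hw hwR).add hK₂
  have dU := dirichletEV_ball_mul_le hr0 hUL fun x hx => hUz _ (hrle x hx)
  have dW := dirichletEV_ball_mul_le hr0 hWL fun x hx => hWz _ (hrle x hx)
  have mU := lintegral_norm_pow hd0 (f := fun s => ENNReal.ofReal (U s ^ 2))
    (hUA.measurable.pow_const 2).ennreal_ofReal
  have mW := lintegral_norm_pow hd0 (f := fun s => ENNReal.ofReal (W s ^ 2))
    (hWA.measurable.pow_const 2).ennreal_ofReal
  have gU := lintegral_fderiv_radial_le hd0 hUA
  have gW := lintegral_fderiv_radial_le hd0 hWA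
  have e1 := lintegral_profile_rpow hv hvR hv0 two_pos
  have e2 := lintegral_profile_rpow hw hwR hw0 two_pos
  simp only [Real.rpow_ofNat] at e1 e2
  have pull : ∀ f : ℝ → ℝ, ∫⁻ s in Ioo 0 T, ENNReal.ofReal
      (unitBallVol d * (isoWeight d s * deriv f s ^ 2)) = ENNReal.ofReal (unitBallVol d) *
      ∫⁻ s in Ioo 0 T, ENNReal.ofReal (isoWeight d s * deriv f s ^ 2) := fun f => by
    rw [← lintegral_const_mul' _ _ ENNReal.ofReal_ne_top]
    simp only [ENNReal.ofReal_mul hω.le]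
  have pV := lintegral_deriv_profile_le hd0 hv hvR T
  have pW := lintegral_deriv_profile_le hd0 hw hwR T
  rw [pull] at pV pW
  rw [← e1, ← e2, ← mul_add]
  calc ENNReal.ofReal (dirichletEV d (ball 0 1)) * (ENNReal.ofReal (unitBallVol d) *
        ((∫⁻ s in Ioi 0, ENNReal.ofReal (P s ^ 2)) + ∫⁻ s in Ioi 0, ENNReal.ofReal (Q s ^ 2)))
      ≤ ENNReal.ofReal (dirichletEV d (ball 0 1)) * (ENNReal.ofReal (unitBallVol d) *
        ((∫⁻ s in Ioi 0, ENNReal.ofReal (U s ^ 2)) +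
          ∫⁻ s in Ioi 0, ENNReal.ofReal (W s ^ 2))) := by gcongr
    _ = ENNReal.ofReal (dirichletEV d (ball 0 1)) *
          (∫⁻ x : EuclideanSpace ℝ (Fin d), ENNReal.ofReal (U (‖x‖ ^ d) ^ 2)) +
        ENNReal.ofReal (dirichletEV d (ball 0 1)) *
          ∫⁻ x : EuclideanSpace ℝ (Fin d), ENNReal.ofReal (W (‖x‖ ^ d) ^ 2) := by
        rw [mU, mW]; ring
    _ ≤ _ := add_le_add dU dW
    _ ≤ ENNReal.ofReal (r ^ 2) * (ENNReal.ofReal (unitBallVol d) *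
          ∫⁻ s in Ioi (0 : ℝ), ENNReal.ofReal (isoWeight d s * deriv U s ^ 2)) +
        ENNReal.ofReal (r ^ 2) * (ENNReal.ofReal (unitBallVol d) *
          ∫⁻ s in Ioi (0 : ℝ), ENNReal.ofReal (isoWeight d s * deriv W s ^ 2)) :=
        add_le_add (mul_le_mul_right gU _) (mul_le_mul_right gW _)
    _ = ENNReal.ofReal (r ^ 2) * (ENNReal.ofReal (unitBallVol d) *
          ((∫⁻ s in Ioi (0 : ℝ), ENNReal.ofReal (isoWeight d s * deriv U s ^ 2)) +
          ∫⁻ s in Ioi (0 : ℝ), ENNReal.ofReal (isoWeight d s * deriv W s ^ 2))) := by ring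
    _ ≤ _ := mul_le_mul_right (mul_le_mul_right henergy _) _
    _ ≤ _ := by rw [mul_add]; exact mul_le_mul_right (add_le_add pV pW) _

theorem enorm_fderiv_posPart_add_negPart_le {E : Type*} [NormedAddCommGroup E] [NormedSpace ℝ E]
    {u : E → ℝ} (hu : Continuous u) (x : E) :
    ‖fderiv ℝ (fun y => max (u y) 0) x‖ₑ ^ 2 + ‖fderiv ℝ (fun y => max (-u y) 0) x‖ₑ ^ 2 ≤
      ‖fderiv ℝ u x‖ₑ ^ 2 := by
  have hneg : ∀ {f : E → ℝ}, f x ≤ 0 → fderiv ℝ (fun y => max (f y) 0) x = 0 := by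
    intro f hf
    apply IsLocalMin.fderiv_eq_zero
    refine Eventually.of_forall fun y => ?_
    dsimp only
    rw [max_eq_right hf]
    exact le_max_right _ _
  have hpos : ∀ {f : E → ℝ}, Continuous f → 0 < f x →
      fderiv ℝ (fun y => max (f y) 0) x = fderiv ℝ f x := by
    intro f hf hfx
    apply Filter.EventuallyEq.fderiv_eq
    filter_upwards [(isOpen_lt continuous_const hf).mem_nhds hfx] with y hy
    exact max_eq_left (le_of_lt hy)
  have hzero : ‖(0 : E →L[ℝ] ℝ)‖ₑ ^ 2 = 0 := by
    rw [← ofReal_norm, norm_zero, ENNReal.ofReal_zero, zero_pow two_ne_zero]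
  have hsymm : ‖fderiv ℝ (fun y => -u y) x‖ₑ = ‖fderiv ℝ u x‖ₑ := by
    rw [fderiv_fun_neg, ← ofReal_norm, norm_neg, ofReal_norm]
  rcases lt_trichotomy (u x) 0 with h | h | h
  · rw [hneg h.le, hpos (f := fun y => -u y) hu.neg (by simpa using h), hzero, hsymm, zero_add]
  · rw [hneg h.le, hneg (f := fun y => -u y) (by simp [h]), hzero, zero_add]
    exact zero_le
  · rw [hpos hu h, hneg (f := fun y => -u y) (by linarith), hzero, add_zero]

section

variable {d : ℕ} {u : EuclideanSpace ℝ (Fin d) → ℝ} {K : NNReal} {R : ℝ}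

theorem ofReal_mul_lintegral_le_of_integral_eq {v w g : EuclideanSpace ℝ (Fin d) → ℝ} {α : ℝ}
    (hv : Integrable v) (hv0 : ∀ x, 0 ≤ v x) (hw : Integrable w) (hw0 : ∀ x, 0 ≤ w x)
    (hgm : Measurable g) (hα : 0 ≤ α) (hg : ∀ᵐ x, α ≤ g x ∧ g x ≤ 1)
    (h : ∫ x, v x * g x = ∫ x, w x * g x) :
    ENNReal.ofReal α * ∫⁻ x, ENNReal.ofReal (v x) ≤ ∫⁻ x, ENNReal.ofReal (w x) := by
  have hgb : ∀ᵐ x, ‖g x‖ ≤ 1 := by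
    filter_upwards [hg] with x hx
    rw [Real.norm_eq_abs, abs_of_nonneg (hα.trans hx.1)]
    exact hx.2
  rw [← ofReal_integral_eq_lintegral_ofReal hv (Eventually.of_forall hv0),
    ← ofReal_integral_eq_lintegral_ofReal hw (Eventually.of_forall hw0),
    ← ENNReal.ofReal_mul hα]
  refine ENNReal.ofReal_le_ofReal ?_
  calc α * ∫ x, v x = ∫ x, v x * α := by rw [integral_mul_const, mul_comm]
    _ ≤ ∫ x, v x * g x := by
        refine integral_mono_ae (hv.mul_const α) (hv.mul_bdd hgm.aestronglyMeasurable hgb) ?_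
        filter_upwards [hg] with x hx
        exact mul_le_mul_of_nonneg_left hx.1 (hv0 x)
    _ = ∫ x, w x * g x := h
    _ ≤ ∫ x, w x := by
        refine integral_mono_ae (hw.mul_bdd hgm.aestronglyMeasurable hgb) hw ?_
        filter_upwards [hg] with x hx
        exact mul_le_of_le_one_right (hw0 x) hx.2

theorem dirichletEV_mul_le_of_twisted (hd : 2 ≤ d) (hu : LipschitzWith K u)
    (hR : ∀ x, R ≤ ‖x‖ → u x = 0) {g : EuclideanSpace ℝ (Fin d) → ℝ} {α s₀ : ℝ}
    (hα : 0 < α) (hα1 : α ≤ 1) (hgm : Measurable g) (hg : ∀ᵐ x, α ≤ g x ∧ g x ≤ 1)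
    (hug : ∫ x, u x * g x = 0) (hs₀ : 0 < s₀)
    (hvol : volume.real {x | 0 < u x} + volume.real {x | 0 < -u x} ≤
      unitBallVol d * ((1 + α ^ ((d : ℝ) / ((d : ℝ) - 1))) * s₀)) :
    dirichletEV d (ball 0 1) * ∫ x, u x ^ 2 ≤
      (s₀ ^ (d : ℝ)⁻¹) ^ 2 * ∫ x, ‖gradient u x‖ ^ 2 := by
  set b := α ^ ((d : ℝ) / ((d : ℝ) - 1)) with hb
  have hω := unitBallVol_pos d
  have hd1 : (2 : ℝ) ≤ d := by exact_mod_cast hd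
  have hb1 : b ≤ 1 :=
    Real.rpow_le_one hα.le hα1 (div_nonneg (by linarith) (by linarith))
  set v : EuclideanSpace ℝ (Fin d) → ℝ := fun x => max (u x) 0 with hv
  set w : EuclideanSpace ℝ (Fin d) → ℝ := fun x => max (-u x) 0 with hw
  have hvK : LipschitzWith K v := hu.max_const 0
  have hwK : LipschitzWith K w := hu.neg.max_const 0
  have hvR : ∀ x, R ≤ ‖x‖ → v x = 0 := fun x hx => by simp [hv, hR x hx]
  have hwR : ∀ x, R ≤ ‖x‖ → w x = 0 := fun x hx => by simp [hw, hR x hx]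
  have hv0 : ∀ x, 0 ≤ v x := fun x => le_max_right _ _
  have hw0 : ∀ x, 0 ≤ w x := fun x => le_max_right _ _
  have hvi : Integrable v :=
    hvK.continuous.integrable_of_hasCompactSupport (hasCompactSupport_of_norm_le hvR)
  have hwi : Integrable w :=
    hwK.continuous.integrable_of_hasCompactSupport (hasCompactSupport_of_norm_le hwR)
  have hgb : ∀ᵐ x, ‖g x‖ ≤ 1 := by
    filter_upwards [hg] with x hx
    rw [Real.norm_eq_abs, abs_of_nonneg (hα.le.trans hx.1)]
    exact hx.2
  have huvw : ∀ x, u x = v x - w x := by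
    intro x
    simp only [hv, hw]
    rcases le_total (u x) 0 with h | h
    · rw [max_eq_right h, max_eq_left (by linarith)]; ring
    · rw [max_eq_left h, max_eq_right (by linarith)]; ring
  have hvwg : ∫ x, v x * g x = ∫ x, w x * g x := by
    rw [← sub_eq_zero, ← integral_sub (hvi.mul_bdd hgm.aestronglyMeasurable hgb)
      (hwi.mul_bdd hgm.aestronglyMeasurable hgb), ← hug]
    refine integral_congr_ae (Eventually.of_forall fun x => ?_)
    simp only [huvw x, sub_mul]
  have h1 := ofReal_mul_lintegral_le_of_integral_eq hvi hv0 hwi hw0 hgm hα.le hg hvwg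
  have h2 := ofReal_mul_lintegral_le_of_integral_eq hwi hw0 hvi hv0 hgm hα.le hg hvwg.symm
  have hvset : {x | 0 < v x} = {x | 0 < u x} := by ext x; simp [hv]
  have hwset : {x | 0 < w x} = {x | 0 < -u x} := by ext x; simp [hw]
  rw [← hvset, ← hwset] at hvol
  have key : ENNReal.ofReal (dirichletEV d (ball 0 1)) *
      ((∫⁻ x, ENNReal.ofReal (v x ^ 2)) + ∫⁻ x, ENNReal.ofReal (w x ^ 2)) ≤
      ENNReal.ofReal ((s₀ ^ (d : ℝ)⁻¹) ^ 2) *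
        ((∫⁻ x, ‖fderiv ℝ v x‖ₑ ^ 2) + ∫⁻ x, ‖fderiv ℝ w x‖ₑ ^ 2) := by
    by_cases hcase : volume.real {x | 0 < w x} ≤ unitBallVol d * s₀
    · exact dirichletEV_mul_le_of_unbalanced hd hvK hvR hv0 hwK hwR hw0 hα hα1 hb hs₀ hvol
        hcase h1
    · have hle : unitBallVol d * ((1 + b) * s₀) ≤ unitBallVol d * s₀ + unitBallVol d * s₀ := by
        have : unitBallVol d * s₀ * b ≤ unitBallVol d * s₀ :=
          mul_le_of_le_one_right (by positivity) hb1
        linarith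
      rw [add_comm (∫⁻ x, ENNReal.ofReal (v x ^ 2)), add_comm (∫⁻ x, ‖fderiv ℝ v x‖ₑ ^ 2)]
      refine dirichletEV_mul_le_of_unbalanced hd hwK hwR hw0 hvK hvR hv0 hα hα1 hb hs₀
        (by linarith) ?_ h2
      push Not at hcase
      linarith
  have hsq : (∫⁻ x, ENNReal.ofReal (v x ^ 2)) + ∫⁻ x, ENNReal.ofReal (w x ^ 2) =
      ENNReal.ofReal (∫ x, u x ^ 2) := by
    rw [ofReal_integral_sq hu hR,
      ← lintegral_add_left (hvK.continuous.measurable.pow_const 2).ennreal_ofReal]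
    refine lintegral_congr fun x => ?_
    rw [← ENNReal.ofReal_add (sq_nonneg _) (sq_nonneg _)]
    congr 1
    simp only [hv, hw]
    rcases le_total (u x) 0 with h | h
    · rw [max_eq_right h, max_eq_left (by linarith)]; ring
    · rw [max_eq_left h, max_eq_right (by linarith)]; ring
  have hgrad : (∫⁻ x, ‖fderiv ℝ v x‖ₑ ^ 2) + ∫⁻ x, ‖fderiv ℝ w x‖ₑ ^ 2 ≤
      ENNReal.ofReal (∫ x, ‖gradient u x‖ ^ 2) := by
    rw [ofReal_integral_gradient_sq hu hR,
      ← lintegral_add_left ((measurable_fderiv ℝ v).enorm.pow_const 2)]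
    exact lintegral_mono fun x => enorm_fderiv_posPart_add_negPart_le hu.continuous x
  rw [hsq] at key
  have := key.trans (mul_le_mul_right hgrad _)
  rw [← ENNReal.ofReal_mul (dirichletEV_nonneg _), ← ENNReal.ofReal_mul (sq_nonneg _)] at this
  exact (ENNReal.ofReal_le_ofReal_iff
    (mul_nonneg (sq_nonneg _) (integral_nonneg fun x => sq_nonneg _))).1 this

theorem integral_sq_pos (hu : LipschitzWith K u) (hR : ∀ x, R ≤ ‖x‖ → u x = 0)
    (hne : ¬ u =ᵐ[volume] fun _ => (0 : ℝ)) : 0 < ∫ x, u x ^ 2 := by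
  have hc : Continuous fun x => u x ^ 2 := hu.continuous.pow 2
  have hR2 : ∀ x, R ≤ ‖x‖ → u x ^ 2 = 0 := fun x hx => by simp [hR x hx]
  refine (integral_nonneg fun x => sq_nonneg _).lt_of_ne fun h => hne ?_
  have := (integral_eq_zero_iff_of_nonneg (fun x => sq_nonneg (u x))
    (hc.integrable_of_hasCompactSupport (hasCompactSupport_of_norm_le hR2))).1 h.symm
  filter_upwards [this] with x hx
  simpa using hx

end

theorem exists_twisted_trial {d : ℕ} (hd : 2 ≤ d) {α : ℝ} (hα : 0 < α)
    {Ω : Set (EuclideanSpace ℝ (Fin d))} (hΩo : IsOpen Ω) (hΩb : Bornology.IsBounded Ω)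
    (hΩn : Ω.Nonempty) {g : EuclideanSpace ℝ (Fin d) → ℝ} (hgm : Measurable g)
    (hg : ∀ᵐ x, α ≤ g x ∧ g x ≤ 1) :
    ∃ u, IsDirTrial d Ω u ∧ (∫ x, u x * g x) = 0 := by
  have : Nonempty (Fin d) := ⟨⟨0, by omega⟩⟩
  have hgb : ∀ᵐ x, ‖g x‖ ≤ 1 := by
    filter_upwards [hg] with x hx
    rw [Real.norm_eq_abs, abs_of_nonneg (hα.le.trans hx.1)]
    exact hx.2
  obtain ⟨p, hp⟩ := hΩn
  obtain ⟨ε, hε, hball⟩ := Metric.isOpen_iff.1 hΩo p hp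
  obtain ⟨e, he⟩ := exists_norm_eq (EuclideanSpace ℝ (Fin d)) (show (0 : ℝ) ≤ ε / 2 by positivity)
  set q := p + e
  have hpq : dist q p = ε / 2 := by simp [q, dist_eq_norm, he]
  set δ := ε / 4 with hδ
  have hδ0 : 0 < δ := by positivity
  let f : EuclideanSpace ℝ (Fin d) → EuclideanSpace ℝ (Fin d) → ℝ := fun c x =>
    max (δ - dist x c) 0
  have hfK : ∀ c, LipschitzWith 1 (f c) := fun c => by
    have h1 : LipschitzWith 1 fun x : EuclideanSpace ℝ (Fin d) => δ - dist x c := by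
      refine LipschitzWith.of_dist_le_mul fun x y => ?_
      rw [dist_sub_left]
      exact (LipschitzWith.dist_left c).dist_le_mul x y
    exact h1.max_const 0
  have hf0 : ∀ c x, 0 ≤ f c x := fun c x => le_max_right _ _
  have hfz : ∀ c x, δ ≤ dist x c → f c x = 0 := fun c x hx =>
    max_eq_right (by linarith)
  have hpΩ : ∀ x ∉ Ω, f p x = 0 := fun x hx => hfz p x <| by
    by_contra! h
    exact hx (hball (mem_ball.2 (by linarith)))
  have hqΩ : ∀ x ∉ Ω, f q x = 0 := fun x hx => hfz q x <| by
    by_contra! h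
    exact hx (hball (mem_ball.2 (by linarith [dist_triangle x q p])))
  have hcs : ∀ {h : EuclideanSpace ℝ (Fin d) → ℝ}, (∀ x ∉ Ω, h x = 0) → HasCompactSupport h :=
    fun {h} hh => HasCompactSupport.intro hΩb.isCompact_closure fun x hx =>
      hh x fun hx' => hx (subset_closure hx')
  have hfg : ∀ c, (∀ x ∉ Ω, f c x = 0) → Integrable fun x => f c x * g x := fun c hc =>
    ((hfK c).continuous.integrable_of_hasCompactSupport (hcs hc)).mul_bdd
      hgm.aestronglyMeasurable hgb
  have hpos : ∀ c, (∀ x ∉ Ω, f c x = 0) → 0 < ∫ x, f c x * g x := by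
    intro c hc
    have hi := (hfK c).continuous.integrable_of_hasCompactSupport (μ := volume) (hcs hc)
    have h1 : 0 < ∫ x, f c x :=
      (hfK c).continuous.integral_pos_of_hasCompactSupport_nonneg_nonzero (hcs hc) (hf0 c)
        (x := c) (by simp [f, hδ0.le, hδ0.ne'])
    calc 0 < α * ∫ x, f c x := by positivity
      _ = ∫ x, f c x * α := by rw [integral_mul_const, mul_comm]
      _ ≤ ∫ x, f c x * g x := by
        refine integral_mono_ae (hi.mul_const α) (hfg c hc) ?_
        filter_upwards [hg] with x hx
        exact mul_le_mul_of_nonneg_left hx.1 (hf0 c x)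
  set a := ∫ x, f q x * g x with ha
  set b := ∫ x, f p x * g x with hb
  have hK : ∃ K, LipschitzWith K fun x => f p x * a - f q x * b := by
    have h1 : LipschitzWith (1 * ‖a‖₊ + 1 * ‖b‖₊) fun x => f p x * a - f q x * b := by
      refine LipschitzWith.of_dist_le_mul fun x y => ?_
      have hp1 := (hfK p).dist_le_mul x y
      have hq1 := (hfK q).dist_le_mul x y
      rw [Real.dist_eq, NNReal.coe_one, one_mul] at hp1 hq1
      rw [Real.dist_eq]
      calc |f p x * a - f q x * b - (f p y * a - f q y * b)|
          = |(f p x - f p y) * a - (f q x - f q y) * b| := by ring_nf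
        _ ≤ |(f p x - f p y) * a| + |(f q x - f q y) * b| := abs_sub _ _
        _ ≤ dist x y * |a| + dist x y * |b| := by
            rw [abs_mul, abs_mul]; gcongr
        _ = _ := by simp; ring
    exact ⟨_, h1⟩
  refine ⟨fun x => f p x * a - f q x * b, ⟨hK, fun x hx => ?_, fun h => ?_⟩, ?_⟩
  · simp [hpΩ x hx, hqΩ x hx]
  · obtain ⟨K, hK⟩ := hK
    have h0 := (hK.continuous.ae_eq_iff_eq volume continuous_const).1 h
    have h1 := congrFun h0 p
    have h2 : f q p = 0 := hfz q p (by rw [dist_comm]; linarith)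
    have h3 : f p p = δ := by simp [f, hδ0.le]
    have h4 : 0 < a := hpos q hqΩ
    simp only [h2, h3, zero_mul, sub_zero] at h1
    exact (mul_pos hδ0 h4).ne' h1
  · have hrw : ∀ x, (f p x * a - f q x * b) * g x = f p x * g x * a - f q x * g x * b :=
      fun x => by ring
    simp only [hrw]
    rw [integral_sub ((hfg p hpΩ).mul_const a) ((hfg q hqΩ).mul_const b), integral_mul_const,
      integral_mul_const, ← ha, ← hb]
    ring

/-- uniform lower bound for scaled twisted eigenvalues with `g ∈ L^∞_α`. -/
theorem stmt14 (d : ℕ) (hd : 2 ≤ d) (α : ℝ) (hα0 : 0 < α) (hα1 : α ≤ 1)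
    (Ω : Set (EuclideanSpace ℝ (Fin d)))
    (hΩo : IsOpen Ω) (hΩb : Bornology.IsBounded Ω) (hΩn : Ω.Nonempty)
    (g : EuclideanSpace ℝ (Fin d) → ℝ) (hgm : Measurable g)
    (hg : ∀ᵐ x, α ≤ g x ∧ g x ≤ 1) :
    (1 + α ^ ((d : ℝ) / ((d : ℝ) - 1))) ^ ((2 : ℝ) / d) *
        ((volume (ball (0 : EuclideanSpace ℝ (Fin d)) 1)).toReal ^ ((2 : ℝ) / d) *
          dirichletEV d (ball (0 : EuclideanSpace ℝ (Fin d)) 1)) ≤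
      (volume Ω).toReal ^ ((2 : ℝ) / d) * twistedEV d Ω g := by
  set b := α ^ ((d : ℝ) / ((d : ℝ) - 1)) with hb
  have hb0 : 0 < b := by positivity
  have hω := unitBallVol_pos d
  have hΩfin : volume Ω ≠ ∞ := hΩb.measure_lt_top.ne
  have hΩpos : 0 < volume.real Ω := ENNReal.toReal_pos (hΩo.measure_pos volume hΩn).ne' hΩfin
  set s₀ := volume.real Ω / (unitBallVol d * (1 + b)) with hs₀def
  have hs₀ : 0 < s₀ := by positivity
  have hΩs : volume.real Ω = unitBallVol d * ((1 + b) * s₀) := by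
    rw [hs₀def]; field_simp
  set ρ := (s₀ ^ (d : ℝ)⁻¹) ^ 2 with hρ
  have hρ0 : 0 < ρ := by positivity
  obtain ⟨R, hΩR⟩ := hΩb.subset_ball 0
  have hlower : dirichletEV d (ball 0 1) / ρ ≤ twistedEV d Ω g := by
    refine le_csInf ?_ ?_
    · obtain ⟨u, hu, hug⟩ := exists_twisted_trial hd hα0 hΩo hΩb hΩn hgm hg
      exact ⟨_, u, hu, hug, rfl⟩
    · rintro _ ⟨u, ⟨⟨K, hK⟩, hu0, hne⟩, hug, rfl⟩
      have hR : ∀ x, R ≤ ‖x‖ → u x = 0 := fun x hx => hu0 x fun hxΩ => by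
        have := hΩR hxΩ
        rw [mem_ball_zero_iff] at this
        linarith
      have hpos := integral_sq_pos hK hR hne
      have hsub1 : {x | 0 < u x} ∪ {x | 0 < -u x} ⊆ Ω := by
        rintro x (hx | hx) <;> by_contra h <;>
          · rw [mem_ofPred_eq, hu0 x h] at hx
            simp at hx
      have hdisj : Disjoint {x | 0 < u x} {x | 0 < -u x} := by
        rw [Set.disjoint_left]
        intro x hx hx'
        rw [mem_ofPred_eq] at hx hx'
        linarith
      have hmeas : MeasurableSet {x | 0 < -u x} :=
        measurableSet_lt measurable_const hK.continuous.neg.measurable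
      have hvol : volume.real {x | 0 < u x} + volume.real {x | 0 < -u x} ≤
          unitBallVol d * ((1 + b) * s₀) := by
        rw [← hΩs, ← measureReal_union hdisj hmeas
          (measure_ne_top_of_subset (subset_union_left.trans hsub1) hΩfin)
          (measure_ne_top_of_subset (subset_union_right.trans hsub1) hΩfin)]
        exact measureReal_mono hsub1 hΩfin
      have := dirichletEV_mul_le_of_twisted hd hK hR hα0 hα1 hgm hg hug hs₀ hvol
      rw [rayleigh, div_le_div_iff₀ hρ0 hpos]
      linarith
  have hpow : (volume Ω).toReal ^ ((2 : ℝ) / d) =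
      (1 + b) ^ ((2 : ℝ) / d) * unitBallVol d ^ ((2 : ℝ) / d) * ρ := by
    change volume.real Ω ^ ((2 : ℝ) / d) = _
    rw [hΩs, Real.mul_rpow hω.le (by positivity), Real.mul_rpow (by positivity) hs₀.le, hρ,
      ← Real.rpow_mul_natCast hs₀.le]
    have : (d : ℝ)⁻¹ * (2 : ℕ) = 2 / d := by push_cast; ring
    rw [this]
    ring
  rw [hpow]
  change (1 + b) ^ ((2 : ℝ) / d) * (unitBallVol d ^ ((2 : ℝ) / d) * _) ≤ _
  calc (1 + b) ^ ((2 : ℝ) / d) * (unitBallVol d ^ ((2 : ℝ) / d) * dirichletEV d (ball 0 1))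
      = (1 + b) ^ ((2 : ℝ) / d) * unitBallVol d ^ ((2 : ℝ) / d) * ρ *
          (dirichletEV d (ball 0 1) / ρ) := by field_simp
    _ ≤ _ := by gcongr
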